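/- arXiv:2109.07310 — 7 statements merged into one kernel-verified Lean document; each statement's English description precedes it below -/
import Mathlib

section
/- Assume the principle (⌐) holds. Then there exist a map c : [ω₂]² → ω₁, a monotone map m : [ω₂]^{<ω} → [ω₂]^{<ω}, and a map r : ω₂ → ω₂ such that: (1) for every finite a ⊆ ω₂ and all distinct α, β ∈ m(a), the agreement set A^c_{α,β} is contained in m(a); and (2) for every finite set d of ordinals less than ω₂ + ω, every function e : [d]² → ω₁, and every function s : d → ω₂ such that e agrees with c on [d ∩ ω₂]², s agrees with r on d ∩ ω₂, and A^e_{α,β} ⊆ ω₂ for all distinct α, β ∈ d ∩ ω₂, there exists an injection ι : d → ω₂ with ι equal to the identity on d ∩ ω₂, c(ι(α), ι(β)) = e(α, β) for all distinct α, β ∈ d, and r(ι(α)) = s(α) for all α ∈ d. -/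
noncomputable def w1 : Ordinal.{0} := (Cardinal.aleph 1).ord
noncomputable def w2 : Ordinal.{0} := (Cardinal.aleph 2).ord

/-- The agreement set of `x` and `y` with respect to the pair-coloring `c`,
computed within the domain `D`. -/
def agreeSet (c : Ordinal.{0} → Ordinal.{0} → Ordinal.{0}) (D : Set Ordinal.{0}) (x y : Ordinal.{0}) :
    Set Ordinal.{0} :=
  {z | z ∈ D ∧ z ≠ x ∧ z ≠ y ∧ c x z = c y z}

/-- `m` is a monotone map from finite subsets of `θ` to finite subsets of `θ`. -/
def IsMonotoneMap (θ : Ordinal.{0}) (m : Set Ordinal.{0} → Set Ordinal.{0}) : Prop :=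
  ∀ a : Set Ordinal.{0}, a.Finite → a ⊆ Set.Iio θ → a ⊆ m a ∧ (m a).Finite ∧ m a ⊆ Set.Iio θ

/-- The diagonalization principle (⌐). -/
def PrincipleDiag : Prop :=
  ∀ f : Ordinal.{0} → Ordinal.{0} → Ordinal.{0},
    (∀ α < w1, ∀ β < w1, f α β < w1) →
    ∀ F : Set Ordinal.{0}, F.Finite → F ⊆ Set.Iio w1 →
      ∀ m : Set Ordinal.{0} → Set Ordinal.{0}, IsMonotoneMap w1 m →
        ∃ g : Ordinal.{0} → Ordinal.{0},
          (∀ β < w1, g β < w1) ∧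
          (∀ β < w1, g β ∉ F) ∧
          ∀ a : Set Ordinal.{0}, a.Finite → a ⊆ Set.Iio w1 →
            ∃ b : Set Ordinal.{0}, b.Finite ∧ a ⊆ b ∧ b ⊆ Set.Iio w1 ∧
              ∀ α ∈ m b, ∀ β < w1, f α β = g β → β ∈ m b

namespace Diag

open Cardinal Ordinal

lemma w1_pos : (0 : Ordinal.{0}) < w1 := by
  unfold w1; rw [lt_ord]; simp

lemma card_w1 : w1.card = ℵ_ 1 := by simp [w1]
lemma card_w2 : w2.card = ℵ_ 2 := by simp [w2]

lemma card_le_of_lt {δ : Ordinal.{0}} (h : δ < w2) : δ.card ≤ ℵ_ 1 := by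
  unfold w2 at h
  rw [lt_ord] at h
  have h2 : (ℵ_ 2 : Cardinal.{0}) = Order.succ (ℵ_ 1) := by
    rw [succ_aleph, one_add_one_eq_two]
  rw [h2] at h
  exact Order.lt_succ_iff.mp h

lemma exists_inj {δ : Ordinal.{0}} (h : δ < w2) :
    ∃ j : Ordinal.{0} → Ordinal.{0}, (∀ x < δ, j x < w1) ∧ Set.InjOn j (Set.Iio δ) := by
  have : Nonempty (Set.Iio δ ↪ Set.Iio w1) := by
    rw [← Cardinal.le_def, Cardinal.mk_Iio_ordinal, Cardinal.mk_Iio_ordinal, Cardinal.lift_le, card_w1]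
    exact card_le_of_lt h
  obtain ⟨f⟩ := this
  refine ⟨fun x => if h : x < δ then (f ⟨x, h⟩ : Ordinal) else 0, ?_, ?_⟩
  · intro x hx
    simp only [hx, dif_pos]
    exact (f ⟨x, hx⟩).2
  · intro x hx y hy hxy
    have hx' : x < δ := hx
    have hy' : y < δ := hy
    simp only [hx', hy', dif_pos] at hxy
    have := f.injective (Subtype.ext hxy)
    exact congrArg Subtype.val this

lemma exists_K : ∃ (K : Ordinal.{0} → ℕ → Ordinal.{0} → Ordinal.{0})
    (p : Ordinal.{0} → Ordinal.{0}),
    (∀ β < w1, ∀ i, ∀ v < w1, K β i v < w1 ∧ p (K β i v) = v) ∧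
    (∀ x, p x < w1) ∧
    (∀ β < w1, ∀ i, ∀ v < w1, ∀ β' < w1, ∀ i', ∀ v' < w1, K β i v = K β' i' v' →
      β = β' ∧ i = i') := by
  have : Nonempty ((Set.Iio w1 × ℕ × Set.Iio w1) ↪ Set.Iio w1) := by
    rw [← Cardinal.le_def]
    have h1 : #(Set.Iio w1) = ℵ_ 1 := by
      rw [Cardinal.mk_Iio_ordinal, card_w1, lift_aleph]; simp
    simp only [mk_prod, h1]
    simp
  obtain ⟨f⟩ := this
  classical
  refine ⟨fun β i v => if h : β < w1 ∧ v < w1 then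
      (f (⟨β, h.1⟩, i, ⟨v, h.2⟩) : Ordinal) else 0,
    fun x => if h : ∃ t, (f t : Ordinal) = x then (h.choose.2.2 : Ordinal) else 0, ?_, ?_, ?_⟩
  · intro β hβ i v hv
    simp only [hβ, hv, and_self, dif_pos]
    refine ⟨(f _).2, ?_⟩
    have h : ∃ t, (f t : Ordinal) = f (⟨β, hβ⟩, i, ⟨v, hv⟩) := ⟨_, rfl⟩
    rw [dif_pos h]
    have := f.injective (Subtype.ext h.choose_spec)
    rw [this]
  · intro x
    dsimp only
    split_ifs with h
    · exact h.choose.2.2.2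
    · exact w1_pos
  · intro β hβ i v hv β' hβ' i' v' hv' h
    simp only [hβ, hv, hβ', hv', and_self, dif_pos] at h
    have := f.injective (Subtype.ext h)
    exact ⟨congrArg (fun t => (t.1 : Ordinal)) this, congrArg (fun t => t.2.1) this⟩

def Closed (c : Ordinal.{0} → Ordinal.{0} → Ordinal.{0}) (δ : Ordinal.{0})
    (b : Set Ordinal.{0}) : Prop :=
  ∀ α ∈ b, ∀ β ∈ b, α ≠ β → ∀ z < δ, z ≠ α → z ≠ β → c α z = c β z → z ∈ b

def Cof (c : Ordinal.{0} → Ordinal.{0} → Ordinal.{0}) (δ : Ordinal.{0}) : Prop :=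
  ∀ a : Set Ordinal.{0}, a.Finite → a ⊆ Set.Iio δ →
    ∃ b : Set Ordinal.{0}, b.Finite ∧ a ⊆ b ∧ b ⊆ Set.Iio δ ∧ Closed c δ b

def Good (c : Ordinal.{0} → Ordinal.{0} → Ordinal.{0}) (δ : Ordinal.{0}) : Prop :=
  (∀ x < δ, ∀ y < δ, x ≠ y → c x y < w1) ∧ Cof c δ

lemma diag (hdiag : PrincipleDiag) {δ : Ordinal.{0}}
    {c : Ordinal.{0} → Ordinal.{0} → Ordinal.{0}} (hc : Cof c δ)
    {j : Ordinal.{0} → Ordinal.{0}} (hj : ∀ x < δ, j x < w1) (hji : Set.InjOn j (Set.Iio δ))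
    {p : Ordinal.{0} → Ordinal.{0}} (hp : ∀ x, p x < w1)
    {F : Set Ordinal.{0}} (hF : F.Finite) (hF1 : F ⊆ Set.Iio w1) :
    ∃ g : Ordinal.{0} → Ordinal.{0}, (∀ x < δ, g x < w1 ∧ g x ∉ F) ∧
      ∀ a : Set Ordinal.{0}, a.Finite → a ⊆ Set.Iio δ →
      ∃ b : Set Ordinal.{0}, b.Finite ∧ a ⊆ b ∧ b ⊆ Set.Iio δ ∧ Closed c δ b ∧
        ∀ α ∈ b, ∀ β < δ, α ≠ β → p (c α β) = g β → β ∈ b := by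
  classical
  have hc' : ∀ a : Set Ordinal.{0}, ∃ b : Set Ordinal.{0}, a.Finite → a ⊆ Set.Iio δ →
      (b.Finite ∧ a ⊆ b ∧ b ⊆ Set.Iio δ ∧ Closed c δ b) := by
    intro a
    by_cases h : a.Finite ∧ a ⊆ Set.Iio δ
    · obtain ⟨b, hb⟩ := hc a h.1 h.2
      exact ⟨b, fun _ _ => hb⟩
    · exact ⟨∅, fun h1 h2 => absurd ⟨h1, h2⟩ h⟩
  choose m hm using hc'
  set q := Function.invFunOn j (Set.Iio δ) with hq
  have hqj : ∀ x < δ, q (j x) = x := fun x hx => hji.leftInvOn_invFunOn hx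
  let pre : Set Ordinal.{0} → Set Ordinal.{0} := fun b => {x | x < δ ∧ j x ∈ b}
  have hpre : ∀ b : Set Ordinal.{0}, b.Finite → (pre b).Finite := by
    intro b hb
    apply Set.Finite.of_finite_image (f := j) (hb.subset _)
    · intro x hx y hy; exact hji hx.1 hy.1
    · rintro _ ⟨x, hx, rfl⟩; exact hx.2
  have hpreδ : ∀ b, pre b ⊆ Set.Iio δ := fun b x hx => hx.1
  obtain ⟨g, hg1, hgF, hg⟩ := hdiag
    (fun α β => p (c (q α) (q β))) (fun _ _ _ _ => hp _) F hF hF1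
    (fun b => b ∪ j '' m (pre b)) (by
      intro b hb hb1
      obtain ⟨h1, h2, h3, h4⟩ := hm (pre b) (hpre b hb) (hpreδ b)
      refine ⟨Set.subset_union_left, hb.union (h1.image _), Set.union_subset hb1 ?_⟩
      rintro _ ⟨x, hx, rfl⟩
      exact hj x (h3 hx))
  refine ⟨fun x => g (j x), fun x hx => ⟨hg1 _ (hj x hx), hgF _ (hj x hx)⟩, ?_⟩
  intro a ha ha1
  obtain ⟨b, hb, hab, hb1, H⟩ := hg (j '' a) (ha.image _) (by
    rintro _ ⟨x, hx, rfl⟩; exact hj x (ha1 hx))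
  obtain ⟨h1, h2, h3, h4⟩ := hm (pre b) (hpre b hb) (hpreδ b)
  refine ⟨m (pre b), h1, fun x hx => h2 ⟨ha1 hx, hab ⟨x, hx, rfl⟩⟩, h3, h4, ?_⟩
  intro α hα β hβ hne heq
  have hαδ : α < δ := h3 hα
  rcases H (j α) (Or.inr ⟨α, hα, rfl⟩) (j β) (hj β hβ) (by simpa [hqj α hαδ, hqj β hβ] using heq)
    with h | ⟨x, hx, hxβ⟩
  · exact h2 ⟨hβ, h⟩
  · rwa [← hji (h3 hx) hβ hxβ]

lemma block {δ z : Ordinal.{0}} (h : δ ≤ z) (h2 : z < δ + ω) : ∃ i : ℕ, z = δ + i := by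
  have : z - δ < ω := by
    rw [← Ordinal.add_sub_cancel_of_le h] at h2
    exact (add_lt_add_iff_left δ).mp h2
  obtain ⟨n, hn⟩ := lt_omega0.mp this
  exact ⟨n, by rw [← hn, Ordinal.add_sub_cancel_of_le h]⟩

structure Valid (δ : Ordinal.{0}) (d : Set Ordinal.{0})
    (e : Ordinal.{0} → Ordinal.{0} → Ordinal.{0}) : Prop where
  fin : d.Finite
  sub : ∀ x ∈ d, x < w2 → x < δ
  symm : ∀ x ∈ d, ∀ y ∈ d, x ≠ y → e x y = e y x
  lt : ∀ x ∈ d, ∀ y ∈ d, x ≠ y → e x y < w1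
  inj : ∀ x ∈ d, ∀ y ∈ d, x < w2 → y < w2 → x ≠ y → ∀ z ∈ d, w2 ≤ z → e x z ≠ e y z

structure Ext (δ : Ordinal.{0}) (d : Set Ordinal.{0})
    (e c c' : Ordinal.{0} → Ordinal.{0} → Ordinal.{0}) : Prop where
  symm : ∀ x y, c' x y = c' y x
  agree : ∀ x < δ, ∀ y < δ, c' x y = c x y
  good : Good c' (δ + ω)
  inj : ∀ z, δ ≤ z → z < δ + ω → ∀ x < δ, ∀ y < δ, x ≠ y → c' x z ≠ c' y z
  real1 : ∀ x ∈ d, x < w2 → ∀ i : ℕ, w2 + i ∈ d → c' x (δ + i) = e x (w2 + i)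
  real2 : ∀ i k : ℕ, i ≠ k → w2 + i ∈ d → w2 + k ∈ d →
    c' (δ + i) (δ + k) = e (w2 + i) (w2 + k)

lemma step (hdiag : PrincipleDiag) {δ : Ordinal.{0}} (hδ : δ < w2)
    {c : Ordinal.{0} → Ordinal.{0} → Ordinal.{0}} (hcs : ∀ x y, c x y = c y x)
    (hc : Good c δ) {d : Set Ordinal.{0}} {e : Ordinal.{0} → Ordinal.{0} → Ordinal.{0}}
    (hv : Valid δ d e) : ∃ c', Ext δ d e c c' := by
  classical
  obtain ⟨j, hj, hji⟩ := exists_inj hδ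
  obtain ⟨K, p, hK, hp, hKi⟩ := exists_K
  set F : Set Ordinal.{0} := insert 0 ((fun t : Ordinal × Ordinal => p (e t.1 t.2)) '' (d ×ˢ d))
    with hFdef
  have hF : F.Finite := ((hv.fin.prod hv.fin).image _).insert 0
  have hF1 : F ⊆ Set.Iio w1 := by
    rintro x (rfl | ⟨t, -, rfl⟩)
    · exact w1_pos
    · exact hp _
  obtain ⟨g, hg, hgb⟩ := diag hdiag hc.2 hj hji hp hF hF1
  have hg0 : ∀ x < δ, g x ≠ 0 := fun x hx h => (hg x hx).2 (by rw [h]; exact Or.inl rfl)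
  have hge : ∀ x < δ, ∀ y ∈ d, ∀ z ∈ d, p (e y z) ≠ g x := fun x hx y hy z hz h =>
    (hg x hx).2 (by rw [← h]; exact Or.inr ⟨(y, z), ⟨hy, hz⟩, rfl⟩)
  let idx : Ordinal.{0} → ℕ := fun z => Cardinal.toNat (z - δ).card
  have hidx : ∀ i : ℕ, idx (δ + i) = i := by
    intro i; simp [idx, Ordinal.add_sub_cancel]
  let h : Ordinal.{0} → ℕ → Ordinal.{0} := fun x i =>
    if x ∈ d ∧ w2 + (i : Ordinal.{0}) ∈ d then e x (w2 + i) else K (j x) i (g x)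
  let k : ℕ → ℕ → Ordinal.{0} := fun i l =>
    if w2 + (i : Ordinal.{0}) ∈ d ∧ w2 + (l : Ordinal.{0}) ∈ d then e (w2 + i) (w2 + l)
    else K 0 (i + l) 0
  let c' : Ordinal.{0} → Ordinal.{0} → Ordinal.{0} := fun x y =>
    if x < δ then (if y < δ then c x y else h x (idx y))
    else (if y < δ then h y (idx x) else k (idx x) (idx y))
  have nlt : ∀ i : ℕ, ¬ (δ + (i : Ordinal.{0}) < δ) := fun i => not_lt.mpr le_self_add
  have c00 : ∀ x < δ, ∀ y < δ, c' x y = c x y := fun x hx y hy => by simp [c', hx, hy]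
  have c01 : ∀ x < δ, ∀ i : ℕ, c' x (δ + i) = h x i := fun x hx i => by
    simp only [c', if_pos hx, if_neg (nlt i), hidx]
  have c10 : ∀ x < δ, ∀ i : ℕ, c' (δ + i) x = h x i := fun x hx i => by
    simp only [c', if_pos hx, if_neg (nlt i), hidx]
  have c11 : ∀ i l : ℕ, c' (δ + i) (δ + l) = k i l := fun i l => by
    simp only [c', if_neg (nlt i), if_neg (nlt l), hidx]
  have wne : ∀ i l : ℕ, i ≠ l → w2 + (i : Ordinal.{0}) ≠ w2 + (l : Ordinal.{0}) := by
    intro i l hil h; exact hil (by simpa using h)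
  have xne : ∀ x < δ, ∀ i : ℕ, x ≠ w2 + (i : Ordinal.{0}) := by
    intro x hx i; exact ((hx.trans hδ).trans_le le_self_add).ne
  have ksymm : ∀ i l, k i l = k l i := by
    intro i l
    by_cases hil : i = l
    · rw [hil]
    · simp only [k, and_comm, add_comm i l]
      split_ifs with h1
      · exact (hv.symm _ h1.2 _ h1.1 (wne _ _ (Ne.symm hil))).symm
      · rfl
  have hlt : ∀ x < δ, ∀ i, h x i < w1 := by
    intro x hx i
    simp only [h]
    split_ifs with h1
    · exact hv.lt _ h1.1 _ h1.2 (xne x hx i)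
    · exact (hK _ (hj x hx) _ _ (hg x hx).1).1
  have klt : ∀ i l, i ≠ l → k i l < w1 := by
    intro i l hil
    simp only [k]
    split_ifs with h1
    · exact hv.lt _ h1.1 _ h1.2 (wne _ _ hil)
    · exact (hK _ w1_pos _ _ w1_pos).1
  have hinj : ∀ i : ℕ, ∀ x < δ, ∀ y < δ, x ≠ y → h x i ≠ h y i := by
    intro i x hx y hy hxy
    simp only [h]
    have pK : ∀ x < δ, p (K (j x) i (g x)) = g x := fun x hx =>
      (hK _ (hj x hx) _ _ (hg x hx).1).2
    split_ifs with h1 h2 h2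
    · exact hv.inj _ h1.1 _ h2.1 (hx.trans hδ) (hy.trans hδ) hxy _ h1.2 le_self_add
    · intro h3
      exact hge y hy _ h1.1 _ h1.2 (by rw [h3, pK y hy])
    · intro h3
      exact hge x hx _ h2.1 _ h2.2 (by rw [← h3, pK x hx])
    · intro h3
      exact hxy (hji hx hy (hKi _ (hj x hx) _ _ (hg x hx).1 _ (hj y hy) _ _ (hg y hy).1 h3).1)
  have c'symm : ∀ x y, c' x y = c' y x := by
    intro x y
    simp only [c']
    split_ifs
    · exact hcs x y
    · rfl
    · rfl
    · exact ksymm _ _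
  have cases' : ∀ z < δ + ω, z < δ ∨ ∃ i : ℕ, z = δ + i := by
    intro z hz
    rcases lt_or_ge z δ with h1 | h1
    · exact Or.inl h1
    · exact Or.inr (block h1 hz)
  refine ⟨c', c'symm, c00, ⟨?_, ?_⟩, ?_, ?_, ?_⟩
  · intro x hx y hy hxy
    rcases cases' x hx with hx | ⟨i, rfl⟩ <;> rcases cases' y hy with hy | ⟨l, rfl⟩
    · rw [c00 _ hx _ hy]; exact hc.1 _ hx _ hy hxy
    · rw [c01 _ hx]; exact hlt _ hx _
    · rw [c10 _ hy]; exact hlt _ hy _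
    · rw [c11]; exact klt _ _ (by rintro rfl; exact hxy rfl)
  · intro a ha haδ
    obtain ⟨b, hb, hab, hbδ, hbc, hbg⟩ := hgb ((a ∪ d) ∩ Set.Iio δ)
      ((ha.union hv.fin).inter_of_left _) Set.inter_subset_right
    have hdb : ∀ x ∈ d, x < δ → x ∈ b := fun x hx h => hab ⟨Or.inr hx, h⟩
    have finN : {z | ∃ i : ℕ, z = δ + (i : Ordinal.{0}) ∧ w2 + (i : Ordinal.{0}) ∈ d}.Finite := by
      refine (hv.fin.image (fun z => δ + (z - w2))).subset ?_
      rintro _ ⟨i, rfl, hi⟩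
      exact ⟨_, hi, by simp [Ordinal.add_sub_cancel]⟩
    have ltω : ∀ i : ℕ, δ + (i : Ordinal.{0}) < δ + ω := fun i => by
      simp
    refine ⟨b ∪ (a ∪ {z | ∃ i : ℕ, z = δ + (i : Ordinal.{0}) ∧ w2 + (i : Ordinal.{0}) ∈ d} ∩
      Set.Ici δ), hb.union (ha.union (finN.inter_of_left _)), ?_, ?_, ?_⟩
    · exact fun x hx => Or.inr (Or.inl hx)
    · rintro x (hx | hx | ⟨⟨i, rfl, hi⟩, -⟩)
      · exact (Set.mem_Iio.mp (hbδ hx)).trans_le le_self_add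
      · exact haδ hx
      · exact ltω i
    · set B := b ∪ (a ∪ {z | ∃ i : ℕ, z = δ + (i : Ordinal.{0}) ∧ w2 + (i : Ordinal.{0}) ∈ d} ∩
        Set.Ici δ) with hB
      have hBδ : ∀ x ∈ B, x < δ + ω := by
        rintro x (hx | hx | ⟨⟨i, rfl, hi⟩, -⟩)
        · exact (Set.mem_Iio.mp (hbδ hx)).trans_le le_self_add
        · exact haδ hx
        · exact ltω i
      have hBb : ∀ x ∈ B, x < δ → x ∈ b := by
        rintro x (hx | hx | ⟨-, hx⟩) hxδ
        · exact hx
        · exact hab ⟨Or.inl hx, hxδ⟩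
        · exact absurd hxδ (not_lt.mpr hx)
      have hBd : ∀ i : ℕ, w2 + (i : Ordinal.{0}) ∈ d → δ + (i : Ordinal.{0}) ∈ B :=
        fun i hi => Or.inr (Or.inr ⟨⟨i, rfl, hi⟩, Set.mem_Ici.mpr le_self_add⟩)
      have pK : ∀ i, ∀ x < δ, p (K (j x) i (g x)) = g x := fun i x hx =>
        (hK _ (hj x hx) _ _ (hg x hx).1).2
      -- mixed pair
      have mixed : ∀ α ∈ b, ∀ i : ℕ, ∀ z < δ + ω, z ≠ α → c' α z = c' (δ + i) z → z ∈ B := by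
        intro α hα i z hz hzα heq
        have hαδ : α < δ := hbδ hα
        rcases cases' z hz with hzδ | ⟨l, rfl⟩
        · rw [c00 _ hαδ _ hzδ, c10 _ hzδ] at heq
          by_cases h1 : z ∈ d ∧ w2 + (i : Ordinal.{0}) ∈ d
          · exact Or.inl (hdb z h1.1 hzδ)
          · simp only [h, if_neg h1] at heq
            exact Or.inl (hbg α hα z hzδ hzα.symm (by rw [heq, pK i z hzδ]))
        · by_cases hl : w2 + (l : Ordinal.{0}) ∈ d
          · exact hBd l hl
          · rw [c01 _ hαδ, c11] at heq
            simp only [h, k, hl, and_false, if_false] at heq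
            have := congrArg p heq
            rw [pK _ _ hαδ, (hK _ w1_pos _ _ w1_pos).2] at this
            exact absurd this (hg0 _ hαδ)
      intro α hα β hβ hαβ z hz hzα hzβ heq
      rcases cases' α (hBδ α hα) with hαδ | ⟨i, rfl⟩ <;>
        rcases cases' β (hBδ β hβ) with hβδ | ⟨l, rfl⟩
      · rcases cases' z hz with hzδ | ⟨n, rfl⟩
        · rw [c00 _ hαδ _ hzδ, c00 _ hβδ _ hzδ] at heq
          exact Or.inl (hbc α (hBb α hα hαδ) β (hBb β hβ hβδ) hαβ z hzδ hzα hzβ heq)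
        · rw [c01 _ hαδ, c01 _ hβδ] at heq
          exact absurd heq (hinj n _ hαδ _ hβδ hαβ)
      · exact mixed α (hBb α hα hαδ) l z hz hzα heq
      · exact mixed β (hBb β hβ hβδ) i z hz hzβ heq.symm
      · have hil : i ≠ l := by rintro rfl; exact hαβ rfl
        rcases cases' z hz with hzδ | ⟨n, rfl⟩
        · by_cases hzd : z ∈ d
          · exact Or.inl (hdb z hzd hzδ)
          · rw [c10 _ hzδ, c10 _ hzδ] at heq
            simp only [h, hzd, false_and, if_false] at heq
            exact absurd (hKi _ (hj z hzδ) _ _ (hg z hzδ).1 _ (hj z hzδ) _ _ (hg z hzδ).1 heq).2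
              hil
        · by_cases hl : w2 + (n : Ordinal.{0}) ∈ d
          · exact hBd n hl
          · rw [c11, c11] at heq
            simp only [k, hl, and_false, if_false] at heq
            have := (hKi _ w1_pos _ _ w1_pos _ w1_pos _ _ w1_pos heq).2
            exact absurd (by omega) hil
  · intro z hz hz2 x hx y hy hxy
    obtain ⟨i, rfl⟩ := block hz hz2
    rw [c01 _ hx, c01 _ hy]
    exact hinj i _ hx _ hy hxy
  · intro x hx hx2 i hi
    rw [c01 _ (hv.sub x hx hx2)]
    simp only [h, hx, hi, and_self, if_true]
  · intro i l hil hi hl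
    rw [c11]
    simp only [k, hi, hl, and_self, if_true]

lemma mul_lt_w2 {ξ : Ordinal.{0}} (h : ξ < w2) : ω * ξ < w2 := by
  unfold w2 at *
  rw [lt_ord] at *
  rw [Ordinal.card_mul]
  refine Cardinal.mul_lt_of_lt (aleph0_le_aleph 2) ?_ h
  rw [card_omega0, aleph0_lt_aleph]
  norm_num

lemma div_lt_w2 {y : Ordinal.{0}} (h : y < w2) : y / ω < w2 :=
  (lt_mul_iff_div_lt omega0_ne_zero).mp (h.trans_le (Ordinal.le_mul_right w2 omega0_pos))

/-- Enumeration of the tasks: every task is listed cofinally often. -/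
lemma exists_tasks : ∃ (D : Ordinal.{0} → Set Ordinal.{0})
    (E : Ordinal.{0} → Ordinal.{0} → Ordinal.{0} → Ordinal.{0})
    (S : Ordinal.{0} → Ordinal.{0} → Ordinal.{0}),
    ∀ (d : Set Ordinal.{0}) (e : Ordinal.{0} → Ordinal.{0} → Ordinal.{0})
      (s : Ordinal.{0} → Ordinal.{0}), d.Finite → d ⊆ Set.Iio (w2 + ω) →
      (∀ x ∈ d, ∀ y ∈ d, x ≠ y → e x y < w2) → (∀ x ∈ d, s x < w2) →
      ∀ η < w2, ∃ ξ, η ≤ ξ ∧ ξ < w2 ∧ D ξ = d ∧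
        (∀ x ∈ d, ∀ y ∈ d, x ≠ y → E ξ x y = e x y) ∧ (∀ x ∈ d, S ξ x = s x) := by
  classical
  let A := Set.Iio (w2 + ω)
  let B := Set.Iio w2
  have hA : #A = ℵ_ 2 := by
    rw [Cardinal.mk_Iio_ordinal, Ordinal.card_add, card_w2, card_omega0,
      Cardinal.add_eq_left (aleph0_le_aleph 2) (aleph0_le_aleph 2), lift_aleph]
    simp
  have hB : #B = ℵ_ 2 := by
    rw [Cardinal.mk_Iio_ordinal, card_w2, lift_aleph]
    simp
  have : Infinite A := by
    rw [Cardinal.infinite_iff, hA]; exact aleph0_le_aleph 2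
  have : Infinite B := by
    rw [Cardinal.infinite_iff, hB]; exact aleph0_le_aleph 2
  have hAB : #(A × B) = ℵ_ 2 := by
    simp only [mk_prod, hA, hB, Cardinal.lift_id]; exact Cardinal.mul_eq_self (aleph0_le_aleph 2)
  have hAAB : #(A × A × B) = ℵ_ 2 := by
    rw [mk_prod, hAB, hA]
    simp only [Cardinal.lift_id]; exact Cardinal.mul_eq_self (aleph0_le_aleph 2)
  have hT : #((Finset (A × B) × Finset (A × A × B)) × B) = ℵ_ 2 := by
    rw [mk_prod, mk_prod, mk_finset_of_infinite, mk_finset_of_infinite, hAB, hAAB, hB]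
    simp only [Cardinal.lift_id, Cardinal.mul_eq_self (aleph0_le_aleph 2)]
  obtain ⟨φ⟩ : Nonempty (B ≃ (Finset (A × B) × Finset (A × A × B)) × B) := by
    rw [← Cardinal.eq, hT, hB]
  let P : Ordinal.{0} → Finset (A × B) × Finset (A × A × B) := fun ξ =>
    if h : ξ ∈ B then (φ ⟨ξ, h⟩).1 else (∅, ∅)
  refine ⟨fun ξ => {x | ∃ t ∈ (P ξ).1, (t.1 : Ordinal) = x},
    fun ξ x y => if h : ∃ t ∈ (P ξ).2, (t.1 : Ordinal) = x ∧ (t.2.1 : Ordinal) = y then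
      (h.choose.2.2 : Ordinal) else 0,
    fun ξ x => if h : ∃ t ∈ (P ξ).1, (t.1 : Ordinal) = x then (h.choose.2 : Ordinal) else 0, ?_⟩
  intro d e s hd hdA he hs η hη
  have hfin1 : {t : A × B | (t.1 : Ordinal) ∈ d ∧ (t.2 : Ordinal) = s t.1}.Finite := by
    apply Set.Finite.of_finite_image (f := fun t : A × B => (t.1 : Ordinal)) (hd.subset _)
    · rintro ⟨a, b⟩ ⟨h1, h2⟩ ⟨a', b'⟩ ⟨h3, h4⟩ h
      have : a = a' := Subtype.ext h
      subst this
      have : b = b' := Subtype.ext (h2.trans h4.symm)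
      rw [this]
    · rintro _ ⟨t, ht, rfl⟩; exact ht.1
  have hfin2 : {t : A × A × B | (t.1 : Ordinal) ∈ d ∧ (t.2.1 : Ordinal) ∈ d ∧
      (t.2.2 : Ordinal) = e t.1 t.2.1}.Finite := by
    apply Set.Finite.of_finite_image (f := fun t : A × A × B => ((t.1 : Ordinal), (t.2.1 : Ordinal)))
      ((hd.prod hd).subset _)
    · rintro ⟨a, b, v⟩ ⟨h1, h2, h5⟩ ⟨a', b', v'⟩ ⟨h3, h4, h6⟩ h
      have h' := Prod.mk.inj h
      have h1 : a = a' := Subtype.ext h'.1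
      have h2 : b = b' := Subtype.ext h'.2
      subst h1 h2
      have : v = v' := Subtype.ext (h5.trans h6.symm)
      rw [this]
    · rintro _ ⟨t, ht, rfl⟩; exact ⟨ht.1, ht.2.1⟩
  -- find a large index
  obtain ⟨ξ, hηξ, hξ, hPξ⟩ : ∃ ξ, η ≤ ξ ∧ ξ < w2 ∧ P ξ = (hfin1.toFinset, hfin2.toFinset) := by
    by_contra hcon
    push Not at hcon
    have hlt : ∀ v : B, (φ.symm ((hfin1.toFinset, hfin2.toFinset), v) : Ordinal) < η := by
      intro v
      by_contra hge
      refine hcon _ (not_lt.mp hge) (φ.symm ((hfin1.toFinset, hfin2.toFinset), v)).2 ?_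
      have : (φ.symm ((hfin1.toFinset, hfin2.toFinset), v) : Ordinal) ∈ B :=
        (φ.symm ((hfin1.toFinset, hfin2.toFinset), v)).2
      simp only [P, dif_pos this]
      simp
    have hle : #B ≤ #(Set.Iio η) := by
      refine Cardinal.mk_le_of_injective (f := fun v : B => (⟨_, hlt v⟩ : Set.Iio η)) ?_
      intro v v' h
      have h1 := congrArg Subtype.val h
      have h2 := φ.symm.injective (Subtype.ext h1)
      exact (Prod.mk.inj h2).2
    rw [Cardinal.mk_Iio_ordinal, Cardinal.mk_Iio_ordinal, Cardinal.lift_le, card_w2] at hle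
    have := Cardinal.lt_ord.mp hη
    exact absurd hle (not_le.mpr this)
  have hP1 : ∀ t ∈ (P ξ).1, (t.2 : Ordinal) = s t.1 := by
    intro t ht
    rw [hPξ] at ht
    exact (hfin1.mem_toFinset.mp ht).2
  have hP2 : ∀ t ∈ (P ξ).2, (t.2.2 : Ordinal) = e t.1 t.2.1 := by
    intro t ht
    rw [hPξ] at ht
    exact (hfin2.mem_toFinset.mp ht).2.2
  refine ⟨ξ, hηξ, hξ, ?_, ?_, ?_⟩
  · ext x
    simp only [Set.mem_ofPred_eq, hPξ, Set.Finite.mem_toFinset]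
    constructor
    · rintro ⟨t, ht, rfl⟩; exact ht.1
    · intro hx
      exact ⟨(⟨x, hdA hx⟩, ⟨s x, hs x hx⟩), ⟨hx, rfl⟩, rfl⟩
  · intro x hx y hy hxy
    have h : ∃ t ∈ (P ξ).2, (t.1 : Ordinal) = x ∧ (t.2.1 : Ordinal) = y := by
      refine ⟨(⟨x, hdA hx⟩, ⟨y, hdA hy⟩, ⟨e x y, he x hx y hy hxy⟩), ?_, rfl, rfl⟩
      simp only [hPξ, Set.Finite.mem_toFinset]
      exact ⟨hx, hy, rfl⟩
    simp only [dif_pos h]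
    rw [hP2 _ h.choose_spec.1, h.choose_spec.2.1, h.choose_spec.2.2]
  · intro x hx
    have h : ∃ t ∈ (P ξ).1, (t.1 : Ordinal) = x := by
      refine ⟨(⟨x, hdA hx⟩, ⟨s x, hs x hx⟩), ?_, rfl⟩
      simp only [hPξ, Set.Finite.mem_toFinset]
      exact ⟨hx, rfl⟩
    simp only [dif_pos h]
    rw [hP1 _ h.choose_spec.1, h.choose_spec.2]

lemma Closed.congr {c c' : Ordinal.{0} → Ordinal.{0} → Ordinal.{0}} {δ : Ordinal.{0}}
    (h : ∀ x < δ, ∀ y < δ, c x y = c' x y) {b : Set Ordinal.{0}} (hb : b ⊆ Set.Iio δ)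
    (H : Closed c δ b) : Closed c' δ b := by
  intro α hα β hβ hne z hz h1 h2 heq
  refine H α hα β hβ hne z hz h1 h2 ?_
  rw [h α (hb hα) z hz, h β (hb hβ) z hz, heq]

lemma Good.congr {c c' : Ordinal.{0} → Ordinal.{0} → Ordinal.{0}} {δ : Ordinal.{0}}
    (h : ∀ x < δ, ∀ y < δ, c x y = c' x y) (H : Good c δ) : Good c' δ := by
  refine ⟨fun x hx y hy hne => ?_, fun a ha ha1 => ?_⟩
  · rw [← h x hx y hy]; exact H.1 x hx y hy hne
  · obtain ⟨b, h1, h2, h3, h4⟩ := H.2 a ha ha1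
    exact ⟨b, h1, h2, h3, h4.congr h h3⟩

lemma valid_empty (δ : Ordinal.{0}) (e : Ordinal.{0} → Ordinal.{0} → Ordinal.{0}) :
    Valid δ ∅ e :=
  ⟨Set.finite_empty, by simp, by simp, by simp, by simp⟩

lemma Ext.mono {δ : Ordinal.{0}} {d : Set Ordinal.{0}}
    {e c c' : Ordinal.{0} → Ordinal.{0} → Ordinal.{0}} (h : Ext δ d e c c')
    {c1 c2 : Ordinal.{0} → Ordinal.{0} → Ordinal.{0}} (h1 : ∀ x < δ, ∀ y < δ, c x y = c1 x y)
    (h2 : ∀ x < δ + ω, ∀ y < δ + ω, c' x y = c2 x y) (hs : ∀ x y, c2 x y = c2 y x)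
    (hv : Valid δ d e) :
    Ext δ d e c1 c2 := by
  have hl : ∀ x < δ, x < δ + ω := fun x hx => hx.trans_le le_self_add
  have hi : ∀ i : ℕ, δ + (i : Ordinal.{0}) < δ + ω := fun i => by simp
  refine ⟨hs, ?_, h.good.congr h2, ?_, ?_, ?_⟩
  · intro x hx y hy
    rw [← h2 x (hl x hx) y (hl y hy), h.agree x hx y hy, h1 x hx y hy]
  · intro z hz hz' x hx y hy hne
    rw [← h2 x (hl x hx) z hz', ← h2 y (hl y hy) z hz']
    exact h.inj z hz hz' x hx y hy hne
  · intro x hx hx2 i hid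
    rw [← h2 x (hl x (hv.sub x hx hx2)) _ (hi i)]
    exact h.real1 x hx hx2 i hid
  · intro i k hik h3 h4
    rw [← h2 _ (hi i) _ (hi k)]
    exact h.real2 i k hik h3 h4

/-- The recursion. -/
lemma exists_c (hdiag : PrincipleDiag) (D : Ordinal.{0} → Set Ordinal.{0})
    (E : Ordinal.{0} → Ordinal.{0} → Ordinal.{0} → Ordinal.{0}) :
    ∃ c : Ordinal.{0} → Ordinal.{0} → Ordinal.{0}, (∀ x y, c x y = c y x) ∧
      ∀ ξ < w2, Good c (ω * ξ) → ∃ d', Valid (ω * ξ) d' (E ξ) ∧ Ext (ω * ξ) d' (E ξ) c c ∧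
        (Valid (ω * ξ) (D ξ) (E ξ) → d' = D ξ) := by
  classical
  let D' : Ordinal.{0} → Set Ordinal.{0} := fun ξ => if Valid (ω * ξ) (D ξ) (E ξ) then D ξ else ∅
  have hD' : ∀ ξ, Valid (ω * ξ) (D' ξ) (E ξ) := by
    intro ξ
    simp only [D']
    split_ifs with h
    · exact h
    · exact valid_empty _ _
  have hst : ∀ (ξ : Ordinal.{0}) (c : Ordinal.{0} → Ordinal.{0} → Ordinal.{0}),
      ∃ c' : Ordinal.{0} → Ordinal.{0} → Ordinal.{0},
      ξ < w2 → (∀ x y, c x y = c y x) → Good c (ω * ξ) → Ext (ω * ξ) (D' ξ) (E ξ) c c' := by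
    intro ξ c
    by_cases h : ξ < w2 ∧ (∀ x y, c x y = c y x) ∧ Good c (ω * ξ)
    · obtain ⟨c', hc'⟩ := step hdiag (mul_lt_w2 h.1) h.2.1 h.2.2 (hD' ξ)
      exact ⟨c', fun _ _ _ => hc'⟩
    · exact ⟨c, fun h1 h2 h3 => absurd ⟨h1, h2, h3⟩ h⟩
  choose st hst using hst
  let body : ∀ ξ : Ordinal.{0}, (∀ η : Ordinal.{0}, η < ξ → Ordinal.{0} → Ordinal.{0} → Ordinal.{0}) →
      (Ordinal.{0} → Ordinal.{0} → Ordinal.{0}) := fun ξ ih =>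
    st ξ (fun x y => if h : max x y / ω < ξ then ih _ h (min x y) (max x y) else 0)
  let R : Ordinal.{0} → Ordinal.{0} → Ordinal.{0} → Ordinal.{0} :=
    (wellFounded_lt (α := Ordinal.{0})).fix body
  let cb : Ordinal.{0} → Ordinal.{0} → Ordinal.{0} → Ordinal.{0} := fun ξ x y =>
    if max x y / ω < ξ then R (max x y / ω) (min x y) (max x y) else 0
  have hR : ∀ ξ, R ξ = st ξ (cb ξ) := by
    intro ξ
    have := (wellFounded_lt (α := Ordinal.{0})).fix_eq body ξ
    exact this
  let c : Ordinal.{0} → Ordinal.{0} → Ordinal.{0} := fun x y =>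
    R (max x y / ω) (min x y) (max x y)
  have hcs : ∀ x y, c x y = c y x := fun x y => by simp only [c, max_comm, min_comm]
  have hcbs : ∀ ξ x y, cb ξ x y = cb ξ y x := fun ξ x y => by simp only [cb, max_comm, min_comm]
  have hccb : ∀ ξ, ∀ x < ω * ξ, ∀ y < ω * ξ, c x y = cb ξ x y := by
    intro ξ x hx y hy
    have : max x y / ω < ξ := (lt_mul_iff_div_lt omega0_ne_zero).mp (max_lt hx hy)
    simp only [c, cb, if_pos this]
  refine ⟨c, hcs, fun ξ hξ hg => ⟨D' ξ, hD' ξ, ?_, fun h => by simp only [D', if_pos h]⟩⟩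
  have hext := hst ξ (cb ξ) hξ (hcbs ξ) (hg.congr (hccb ξ))
  refine hext.mono (fun x hx y hy => (hccb ξ x hx y hy).symm) ?_ hcs (hD' ξ)
  intro x hx y hy
  by_cases h : max x y < ω * ξ
  · rw [hext.agree x ((le_max_left _ _).trans_lt h) y ((le_max_right _ _).trans_lt h)]
    exact (hccb ξ x ((le_max_left _ _).trans_lt h) y ((le_max_right _ _).trans_lt h)).symm
  · have h2 : max x y / ω = ξ := by
      obtain ⟨i, hi⟩ := block (not_lt.mp h) (max_lt hx hy)
      rw [hi, mul_add_div _ omega0_ne_zero, Ordinal.div_eq_zero_of_lt (natCast_lt_omega0 i), add_zero]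
    have h3 : c x y = st ξ (cb ξ) (min x y) (max x y) := by
      rw [← hR]; simp only [c, h2]
    rw [h3]
    rcases le_total x y with hxy | hxy
    · rw [min_eq_left hxy, max_eq_right hxy]
    · rw [min_eq_right hxy, max_eq_left hxy, hext.symm]

lemma div_block (z : Ordinal.{0}) : ω * (z / ω) ≤ z ∧ z < ω * (z / ω) + ω :=
  ⟨mul_div_le _ _, lt_mul_div_add _ omega0_ne_zero⟩

/-- Closed sets persist, if the later rows are injective. -/
lemma Closed.persist {c : Ordinal.{0} → Ordinal.{0} → Ordinal.{0}} {ξ θ : Ordinal.{0}}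
    (hinj : ∀ z < θ, ∀ x < ω * (z / ω), ∀ y < ω * (z / ω), x ≠ y → c x z ≠ c y z)
    {b : Set Ordinal.{0}} (hb : b ⊆ Set.Iio (ω * ξ)) (H : Closed c (ω * ξ) b) : Closed c θ b := by
  intro α hα β hβ hne z hz h1 h2 heq
  by_cases hzξ : z < ω * ξ
  · exact H α hα β hβ hne z hzξ h1 h2 heq
  · have : ξ ≤ z / ω := by
      by_contra h
      exact hzξ ((lt_mul_iff_div_lt omega0_ne_zero).mpr (not_le.mp h))
    have hle : ω * ξ ≤ ω * (z / ω) := mul_le_mul_right this ω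
    exact absurd heq (hinj z hz α ((Set.mem_Iio.mp (hb hα)).trans_le hle) β
      ((Set.mem_Iio.mp (hb hβ)).trans_le hle) hne)

end Diag

open Diag Ordinal Cardinal in
theorem stmt_0 (hdiag : PrincipleDiag) :
    ∃ (c : Ordinal.{0} → Ordinal.{0} → Ordinal.{0}) (m : Set Ordinal.{0} → Set Ordinal.{0})
      (r : Ordinal.{0} → Ordinal.{0}),
      (∀ x y, c x y = c y x) ∧
      (∀ x y, x < w2 → y < w2 → x ≠ y → c x y < w1) ∧
      IsMonotoneMap w2 m ∧
      (∀ x < w2, r x < w2) ∧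
      -- (1) closure of m(a) under agreement sets
      (∀ a : Set Ordinal.{0}, a.Finite → a ⊆ Set.Iio w2 →
        ∀ α ∈ m a, ∀ β ∈ m a, α ≠ β → agreeSet c (Set.Iio w2) α β ⊆ m a) ∧
      -- (2) the colored finite extension property
      (∀ d : Set Ordinal.{0}, d.Finite → d ⊆ Set.Iio (w2 + Ordinal.omega0.{0}) →
        ∀ e : Ordinal.{0} → Ordinal.{0} → Ordinal.{0},
          (∀ x y, e x y = e y x) →
          (∀ x ∈ d, ∀ y ∈ d, x ≠ y → e x y < w1) →
          ∀ s : Ordinal.{0} → Ordinal.{0}, (∀ x ∈ d, s x < w2) →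
            (∀ x ∈ d, ∀ y ∈ d, x < w2 → y < w2 → x ≠ y → e x y = c x y) →
            (∀ x ∈ d, x < w2 → s x = r x) →
            (∀ x ∈ d, ∀ y ∈ d, x < w2 → y < w2 → x ≠ y →
              agreeSet e d x y ⊆ Set.Iio w2) →
            ∃ ι : Ordinal.{0} → Ordinal.{0},
              Set.InjOn ι d ∧
              (∀ x ∈ d, ι x < w2) ∧
              (∀ x ∈ d, x < w2 → ι x = x) ∧
              (∀ x ∈ d, ∀ y ∈ d, x ≠ y → c (ι x) (ι y) = e x y) ∧
              (∀ x ∈ d, r (ι x) = s x)) := by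
  classical
  obtain ⟨D, E, S, hT⟩ := exists_tasks
  obtain ⟨c, hcs, hc⟩ := exists_c hdiag D E
  have hgood : ∀ ξ < w2, Good c (ω * ξ) := by
    intro ξ
    induction ξ using WellFoundedLT.induction with
    | _ ξ ih =>
      intro hξ
      have hdiv : ∀ z < ω * ξ, z / ω < ξ := fun z hz =>
        (lt_mul_iff_div_lt omega0_ne_zero).mp hz
      have hinj : ∀ z < ω * ξ, ∀ x < ω * (z / ω), ∀ y < ω * (z / ω), x ≠ y → c x z ≠ c y z := by
        intro z hz
        have h1 := hdiv z hz
        obtain ⟨d', -, hext, -⟩ := hc (z / ω) (h1.trans hξ) (ih _ h1 (h1.trans hξ))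
        exact hext.inj z (div_block z).1 (div_block z).2
      have hnext : ∀ η < ξ, Good c (ω * Order.succ η) := by
        intro η hη
        obtain ⟨d', -, hext, -⟩ := hc η (hη.trans hξ) (ih _ hη (hη.trans hξ))
        rw [mul_succ]
        exact hext.good
      have hmem : ∀ z, z < ω * Order.succ (z / ω) := fun z => lt_mul_succ_div z omega0_ne_zero
      refine ⟨?_, ?_⟩
      · intro x hx y hy hxy
        have hm : max x y < ω * ξ := max_lt hx hy
        have h1 := hmem (max x y)
        exact (hnext _ (hdiv _ hm)).1 x ((le_max_left _ _).trans_lt h1) y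
          ((le_max_right _ _).trans_lt h1) hxy
      · intro a ha haξ
        rcases a.eq_empty_or_nonempty with rfl | hne
        · exact ⟨∅, Set.finite_empty, subset_rfl, haξ, fun α hα => absurd hα (by simp)⟩
        · obtain ⟨y, hy, hmax⟩ := Set.exists_max_image a id ha hne
          have hyξ : y / ω < ξ := hdiv y (haξ hy)
          obtain ⟨b, hb, hab, hbs, hbc⟩ := (hnext _ hyξ).2 a ha
            (fun x hx => (hmax x hx).trans_lt (hmem y))
          have hle : ω * Order.succ (y / ω) ≤ ω * ξ :=
            mul_le_mul_right (Order.succ_le_of_lt hyξ) ω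
          exact ⟨b, hb, hab, fun x hx => (Set.mem_Iio.mp (hbs hx)).trans_le hle,
            hbc.persist hinj hbs⟩
  have hinj : ∀ z < w2, ∀ x < ω * (z / ω), ∀ y < ω * (z / ω), x ≠ y → c x z ≠ c y z := by
    intro z hz
    have h1 := div_lt_w2 hz
    obtain ⟨d', -, hext, -⟩ := hc (z / ω) h1 (hgood _ h1)
    exact hext.inj z (div_block z).1 (div_block z).2
  have w2pos : (0 : Ordinal.{0}) < w2 := by
    unfold w2; rw [lt_ord, card_zero]; exact aleph0_pos.trans_le (aleph0_le_aleph 2)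
  have hw2 : ∀ x < w2, Order.succ x < w2 := fun x hx =>
    (Cardinal.isSuccLimit_ord (aleph0_le_aleph 2)).succ_lt hx
  have hle : ∀ x : Ordinal.{0}, x ≤ ω * x := fun x => Ordinal.le_mul_right x omega0_pos
  have hbd : ∀ a : Set Ordinal.{0}, a.Finite → a ⊆ Set.Iio w2 →
      ∃ ξ < w2, a ⊆ Set.Iio (ω * ξ) := by
    intro a ha haw
    rcases a.eq_empty_or_nonempty with rfl | hne
    · exact ⟨0, w2pos, by simp⟩
    · obtain ⟨y, hy, hmax⟩ := Set.exists_max_image a id ha hne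
      exact ⟨Order.succ y, hw2 y (haw hy), fun x hx =>
        ((hmax x hx).trans_lt (Order.lt_succ y)).trans_le (hle _)⟩
  have hm : ∀ a : Set Ordinal.{0}, ∃ b : Set Ordinal.{0}, a.Finite → a ⊆ Set.Iio w2 →
      (b.Finite ∧ a ⊆ b ∧ b ⊆ Set.Iio w2 ∧ Closed c w2 b) := by
    intro a
    by_cases h : a.Finite ∧ a ⊆ Set.Iio w2
    · obtain ⟨ξ, hξ, haξ⟩ := hbd a h.1 h.2
      obtain ⟨b, hb, hab, hbs, hbc⟩ := (hgood ξ hξ).2 a h.1 haξ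
      exact ⟨b, fun _ _ => ⟨hb, hab, fun x hx => (Set.mem_Iio.mp (hbs hx)).trans (mul_lt_w2 hξ),
        hbc.persist hinj hbs⟩⟩
    · exact ⟨∅, fun h1 h2 => absurd ⟨h1, h2⟩ h⟩
  choose m hm using hm
  have w12 : w1 < w2 := by
    unfold w1 w2; rw [Cardinal.ord_lt_ord, Cardinal.aleph_lt_aleph]; norm_num
  refine ⟨c, m, fun y => if S (y / ω) (w2 + y % ω) < w2 then S (y / ω) (w2 + y % ω) else 0,
    hcs, ?_, ?_, ?_, ?_, ?_⟩
  · intro x y hx hy hxy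
    obtain ⟨ξ, hξ, h⟩ := hbd {x, y} (by simp) (by
      rintro z (rfl | rfl) <;> assumption)
    exact (hgood ξ hξ).1 x (h (by simp)) y (h (by simp)) hxy
  · intro a ha ha1
    obtain ⟨h1, h2, h3, -⟩ := hm a ha ha1
    exact ⟨h2, h1, h3⟩
  · intro x _
    dsimp only
    split_ifs with h
    · exact h
    · exact w2pos
  · intro a ha ha1 α hα β hβ hne z hz
    exact (hm a ha ha1).2.2.2 α hα β hβ hne z hz.1 hz.2.1 hz.2.2.1 hz.2.2.2
  · intro d hd hdw e hes he s hs hec hsr hagree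
    obtain ⟨η, hη, hdη⟩ := hbd (d ∩ Set.Iio w2) (hd.inter_of_left _) Set.inter_subset_right
    obtain ⟨ξ, hηξ, hξ, hDξ, hEξ, hSξ⟩ := hT d e s hd hdw
      (fun x hx y hy h => (he x hx y hy h).trans w12) hs η hη
    have hV : Valid (ω * ξ) (D ξ) (E ξ) := by
      rw [hDξ]
      refine ⟨hd, ?_, ?_, ?_, ?_⟩
      · intro x hx hx2
        exact (Set.mem_Iio.mp (hdη ⟨hx, hx2⟩)).trans_le (mul_le_mul_right hηξ ω)
      · intro x hx y hy h
        rw [hEξ x hx y hy h, hEξ y hy x hx h.symm, hes]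
      · intro x hx y hy h
        rw [hEξ x hx y hy h]; exact he x hx y hy h
      · intro x hx y hy hx2 hy2 hne z hz hz2
        have hxz : x ≠ z := (hx2.trans_le hz2).ne
        have hyz : y ≠ z := (hy2.trans_le hz2).ne
        rw [hEξ x hx z hz hxz, hEξ y hy z hz hyz]
        intro heq
        have : z < w2 := hagree x hx y hy hx2 hy2 hne ⟨hz, hxz.symm, hyz.symm, heq⟩
        exact absurd hz2 (not_le.mpr this)
    obtain ⟨d', -, hext, hd'⟩ := hc ξ hξ (hgood ξ hξ)
    obtain rfl := hd' hV
    have hδ := mul_lt_w2 hξ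
    have hsub : ∀ x ∈ d, x < w2 → x < ω * ξ := by
      have := hV.sub
      rwa [hDξ] at this
    have hcase : ∀ x ∈ d, x < w2 ∨ ∃ i : ℕ, x = w2 + i := by
      intro x hx
      rcases lt_or_ge x w2 with h | h
      · exact Or.inl h
      · exact Or.inr (block h (hdw hx))
    let ι : Ordinal.{0} → Ordinal.{0} := fun x => if x < w2 then x else ω * ξ + (x - w2)
    have ι0 : ∀ x < w2, ι x = x := fun x hx => if_pos hx
    have ι1 : ∀ i : ℕ, ι (w2 + i) = ω * ξ + i := fun i => by
      simp only [ι, if_neg (not_lt.mpr (le_self_add : w2 ≤ w2 + (i : Ordinal.{0}))),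
        Ordinal.add_sub_cancel]
    have r1 := hext.real1
    have r2 := hext.real2
    rw [hDξ] at r1 r2
    refine ⟨ι, ?_, ?_, fun x _ hx => ι0 x hx, ?_, ?_⟩
    · intro x hx y hy hxy
      rcases hcase x hx with hx2 | ⟨i, rfl⟩ <;> rcases hcase y hy with hy2 | ⟨k, rfl⟩
      · rwa [ι0 x hx2, ι0 y hy2] at hxy
      · rw [ι0 x hx2, ι1] at hxy
        have := hsub x hx hx2
        rw [hxy] at this
        exact absurd this (not_lt.mpr le_self_add)
      · rw [ι0 y hy2, ι1] at hxy
        have := hsub y hy hy2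
        rw [← hxy] at this
        exact absurd this (not_lt.mpr le_self_add)
      · rw [ι1, ι1] at hxy
        have : i = k := by simpa using hxy
        rw [this]
    · intro x hx
      rcases hcase x hx with hx2 | ⟨i, rfl⟩
      · rwa [ι0 x hx2]
      · rw [ι1]
        refine lt_of_lt_of_le ((add_lt_add_iff_left _).mpr (natCast_lt_omega0 i)) ?_
        rw [← mul_succ]
        exact (mul_lt_w2 (hw2 ξ hξ)).le
    · intro x hx y hy hxy
      rcases hcase x hx with hx2 | ⟨i, rfl⟩ <;> rcases hcase y hy with hy2 | ⟨k, rfl⟩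
      · rw [ι0 x hx2, ι0 y hy2, hec x hx y hy hx2 hy2 hxy]
      · rw [ι0 x hx2, ι1, r1 x hx hx2 k hy, hEξ _ hx _ hy hxy]
      · rw [ι0 y hy2, ι1, hcs, r1 y hy hy2 i hx, hEξ _ hy _ hx hxy.symm, hes]
      · rw [ι1, ι1, r2 i k (by rintro rfl; exact hxy rfl) hx hy, hEξ _ hx _ hy hxy]
    · intro x hx
      rcases hcase x hx with hx2 | ⟨i, rfl⟩
      · rw [ι0 x hx2]; exact (hsr x hx hx2).symm
      · have h1 : (ω * ξ + (i : Ordinal.{0})) / ω = ξ := by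
          rw [mul_add_div _ omega0_ne_zero, Ordinal.div_eq_zero_of_lt (natCast_lt_omega0 i),
            add_zero]
        have h2 : (ω * ξ + (i : Ordinal.{0})) % ω = i := by
          rw [mul_add_mod_self, Ordinal.mod_eq_of_lt (natCast_lt_omega0 i)]
        rw [ι1]
        simp only [h1, h2, hSξ _ hx, if_pos (hs _ hx)]
end

section
/- Assume the principle (⌐) holds. Then there exist a map c : [ω₂]² → ω₁ and a map r : ω₂ → ω₂ such that: (a) for all distinct β, γ < ω₂, the agreement set A^c_{β,γ} is finite; (b) every finite a ⊆ ω₂ is contained in a finite b ⊆ ω₂ that is closed under A^c, i.e., A^c_{β,γ} ⊆ b for all distinct β, γ ∈ b; and (c) for every finite set d of ordinals less than ω₂ + ω, every function e : [d]² → ω₁ with e ↾ [d ∩ ω₂]² = c ↾ [d ∩ ω₂]² that introduces no new agreements over c ↾ [d ∩ ω₂]², and every function s : d → ω₂ with s ↾ (d ∩ ω₂) = r ↾ (d ∩ ω₂), there exists an injection ι : d → ω₂ with ι equal to the identity on d ∩ ω₂, c(ι(β), ι(γ)) = e(β, γ) for all distinct β, γ ∈ d, and r(ι(β)) = s(β)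 for all β ∈ d. -/
universe u v

section Core

open Cardinal

/-- Set version of the diagonalization principle, for sets injecting into `ω₁`. -/
theorem diag_set (hdiag : PrincipleDiag) {T : Type 1} [Nonempty T] (S : Set T)
    (h : T → Set.Iio w1) (hinj : Set.InjOn h S) (f : T → T → Set.Iio w1)
    (F : Set (Set.Iio w1)) (hF : F.Finite) (m : Set T → Set T)
    (hm : ∀ a : Set T, a.Finite → a ⊆ S → a ⊆ m a ∧ (m a).Finite ∧ m a ⊆ S) :
    ∃ g : T → Set.Iio w1, (∀ x, g x ∉ F) ∧ ∀ a : Set T, a.Finite → a ⊆ S →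
      ∃ b : Set T, b.Finite ∧ a ⊆ b ∧ b ⊆ S ∧
        ∀ α ∈ m b, ∀ β ∈ S, f α β = g β → β ∈ m b := by
  classical
  let hv : T → Ordinal.{0} := fun t => (h t).1
  have hinj' : Set.InjOn hv S := fun x hx y hy hxy => hinj hx hy (Subtype.ext hxy)
  have hh' : ∀ t, hv t < w1 := fun t => (h t).2
  let k : Ordinal.{0} → T := Function.invFunOn hv S
  have hk : ∀ x ∈ S, k (hv x) = x := fun x hx =>
    hinj' (Function.invFunOn_mem ⟨x, hx, rfl⟩) hx (Function.invFunOn_eq (f := hv) ⟨x, hx, rfl⟩)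
  let p : Set Ordinal.{0} → Set T := fun A => S ∩ hv ⁻¹' A
  have hp : ∀ A : Set Ordinal.{0}, A.Finite → (p A).Finite := by
    intro A hA
    refine Set.Finite.of_finite_image (f := hv) (hA.subset ?_) (hinj'.mono Set.inter_subset_left)
    rintro _ ⟨x, hx, rfl⟩
    exact hx.2
  obtain ⟨g', hg1, hg2, hg3⟩ := hdiag (fun α β => (f (k α) (k β)).1)
    (fun α _ β _ => (f (k α) (k β)).2) (Subtype.val '' F) (hF.image _)
    (by rintro _ ⟨x, _, rfl⟩; exact x.2) (fun A => A ∪ hv '' (m (p A))) (by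
      intro A hA hAw
      have := hm (p A) (hp A hA) Set.inter_subset_left
      refine ⟨Set.subset_union_left, hA.union (this.2.1.image _), Set.union_subset hAw ?_⟩
      rintro _ ⟨x, _, rfl⟩
      exact hh' x)
  refine ⟨fun t => ⟨g' (hv t), hg1 _ (hh' t)⟩, fun x hx => hg2 _ (hh' x) ⟨_, hx, rfl⟩, ?_⟩
  intro a ha haS
  obtain ⟨b, hb, hab, hbw, hb'⟩ := hg3 (hv '' a) (ha.image _)
    (by rintro _ ⟨x, _, rfl⟩; exact hh' x)
  refine ⟨p b, hp b hb, fun x hx => ⟨haS hx, hab ⟨x, hx, rfl⟩⟩, Set.inter_subset_left, ?_⟩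
  intro α hα β hβ hfg
  have hmm := hm (p b) (hp b hb) Set.inter_subset_left
  have := hb' (hv α) (Or.inr ⟨α, hα, rfl⟩) (hv β) (hh' β) (by
    rw [hk α (hmm.2.2 hα), hk β hβ, hfg])
  rcases this with h1 | ⟨γ, hγ, hγβ⟩
  · exact hmm.1 ⟨hβ, h1⟩
  · rwa [← hinj' (hmm.2.2 hγ) hβ hγβ]

variable {K W : Type 1} [LinearOrder K]

open Classical in
/-- value between a later point `z` and an earlier point `x` -/
noncomputable def crossC (code1 : W → ℕ → W → W) (h : K → K × ℕ → W)
    (D : K → Finset (K × ℕ)) (N : K → Finset ℕ) (e0 : K → ℕ → K × ℕ → W)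
    (g : K → K × ℕ → W) (z x : K × ℕ) : W :=
  if z.2 ∈ N z.1 ∧ x ∈ D z.1 then e0 z.1 z.2 x else code1 (h z.1 x) z.2 (g z.1 x)

open Classical in
/-- value inside a block -/
noncomputable def blockC (code2 : ℕ → ℕ → W) (N : K → Finset ℕ) (e1 : K → ℕ → ℕ → W)
    (ξ : K) (i j : ℕ) : W :=
  if i ∈ N ξ ∧ j ∈ N ξ then e1 ξ i j else code2 i j

open Classical in
/-- the coloring -/
noncomputable def colC (code1 : W → ℕ → W → W) (code2 : ℕ → ℕ → W) (h : K → K × ℕ → W)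
    (D : K → Finset (K × ℕ)) (N : K → Finset ℕ) (e0 : K → ℕ → K × ℕ → W)
    (e1 : K → ℕ → ℕ → W) (g : K → K × ℕ → W) (x y : K × ℕ) : W :=
  if x.1 < y.1 then crossC code1 h D N e0 g y x
  else if y.1 < x.1 then crossC code1 h D N e0 g x y
  else blockC code2 N e1 x.1 (min x.2 y.2) (max x.2 y.2)

/-- Requirement on the function chosen at stage `ξ`. -/
def StageP (third : W → W) (D : K → Finset (K × ℕ)) (N : K → Finset ℕ)
    (e0 : K → ℕ → K × ℕ → W) (ξ : K) (c : K × ℕ → K × ℕ → W) (u : K × ℕ → W) : Prop :=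
  (∀ x, x.1 < ξ → ∀ i ∈ N ξ, ∀ y ∈ D ξ, u x ≠ third (e0 ξ i y)) ∧
  ∀ a : Set (K × ℕ), a.Finite → (∀ x ∈ a, x.1 < ξ) →
    ∃ B : Set (K × ℕ), B.Finite ∧ a ⊆ B ∧ (D ξ : Set (K × ℕ)) ⊆ B ∧ (∀ x ∈ B, x.1 < ξ) ∧
      (∀ x ∈ B, ∀ y ∈ B, x ≠ y → ∀ z, z.1 < ξ → z ≠ x → z ≠ y → c x z = c y z → z ∈ B) ∧
      ∀ x ∈ B, ∀ y, y.1 < ξ → third (c x y) = u y → y ∈ B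

theorem StageP.congr {third : W → W} {D : K → Finset (K × ℕ)} {N : K → Finset ℕ}
    {e0 : K → ℕ → K × ℕ → W} {ξ : K} {c c' : K × ℕ → K × ℕ → W} {u : K × ℕ → W}
    (hc : ∀ x y, x.1 < ξ → y.1 < ξ → c x y = c' x y)
    (H : StageP third D N e0 ξ c u) : StageP third D N e0 ξ c' u := by
  refine ⟨H.1, fun a ha haξ => ?_⟩
  obtain ⟨B, h1, h2, h3, h4, h5, h6⟩ := H.2 a ha haξ
  refine ⟨B, h1, h2, h3, h4, ?_, ?_⟩
  · intro x hx y hy hxy z hz hzx hzy hcz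
    rw [← hc x z (h4 x hx) hz, ← hc y z (h4 y hy) hz] at hcz
    exact h5 x hx y hy hxy z hz hzx hzy hcz
  · intro x hx y hy hcz
    rw [← hc x y (h4 x hx) hy] at hcz
    exact h6 x hx y hy hcz

section Fixed

variable (code1 : W → ℕ → W → W) (code2 : ℕ → ℕ → W) (h : K → K × ℕ → W)
    (D : K → Finset (K × ℕ)) (N : K → Finset ℕ) (e0 : K → ℕ → K × ℕ → W)
    (e1 : K → ℕ → ℕ → W) (g : K → K × ℕ → W) (third : W → W)

theorem colC_symm (x y : K × ℕ) :
    colC code1 code2 h D N e0 e1 g x y = colC code1 code2 h D N e0 e1 g y x := by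
  unfold colC
  rcases lt_trichotomy x.1 y.1 with hl | hl | hl
  · simp [hl, hl.not_gt]
  · simp [hl, min_comm, max_comm]
  · simp [hl, hl.not_gt]

theorem colC_lt {x z : K × ℕ} (hl : x.1 < z.1) :
    colC code1 code2 h D N e0 e1 g x z = crossC code1 h D N e0 g z x := by
  simp [colC, hl]

theorem colC_gt {x z : K × ℕ} (hl : x.1 < z.1) :
    colC code1 code2 h D N e0 e1 g z x = crossC code1 h D N e0 g z x := by
  rw [colC_symm, colC_lt _ _ _ _ _ _ _ _ hl]

theorem colC_eq {x z : K × ℕ} (hl : x.1 = z.1) :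
    colC code1 code2 h D N e0 e1 g x z
      = blockC code2 N e1 z.1 (min x.2 z.2) (max x.2 z.2) := by
  simp [colC, hl]

theorem colC_congr {g' : K → K × ℕ → W} {x y : K × ℕ} (hx : g x.1 = g' x.1)
    (hy : g y.1 = g' y.1) :
    colC code1 code2 h D N e0 e1 g x y = colC code1 code2 h D N e0 e1 g' x y := by
  simp [colC, crossC, hx, hy]

/-- assumptions on the coding functions -/
structure GoodCode : Prop where
  inj1 : ∀ a i w a' i' w', code1 a i w = code1 a' i' w' → a = a' ∧ i = i' ∧ w = w'
  inj2 : ∀ i j i' j', code2 i j = code2 i' j' → i = i' ∧ j = j'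
  ne12 : ∀ a i w j k, code1 a i w ≠ code2 j k
  third_eq : ∀ a i w, third (code1 a i w) = w

variable {code1 code2 h D N e0 e1 g third}

theorem no_later (hc : GoodCode code1 code2 third)
    (hh : ∀ ξ, Set.InjOn (h ξ) {t | t.1 < ξ})
    (he0 : ∀ ξ, ∀ i ∈ N ξ, Set.InjOn (e0 ξ i) (D ξ))
    {x y z : K × ℕ} {c : K × ℕ → K × ℕ → W} (hP : StageP third D N e0 z.1 c (g z.1))
    (hx : x.1 < z.1) (hy : y.1 < z.1)
    (hxy : colC code1 code2 h D N e0 e1 g x z = colC code1 code2 h D N e0 e1 g y z) : x = y := by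
  rw [colC_lt _ _ _ _ _ _ _ _ hx, colC_lt _ _ _ _ _ _ _ _ hy] at hxy
  unfold crossC at hxy
  split_ifs at hxy with h1 h2 h2
  · exact he0 z.1 z.2 h1.1 h1.2 h2.2 hxy
  · exfalso
    apply hP.1 y hy z.2 h1.1 x h1.2
    rw [hxy, hc.third_eq]
  · exfalso
    apply hP.1 x hx z.2 h2.1 y h2.2
    rw [← hxy, hc.third_eq]
  · exact hh z.1 hx hy (hc.inj1 _ _ _ _ _ _ hxy).1

theorem no_block (hc : GoodCode code1 code2 third)
    (hh : ∀ ξ, Set.InjOn (h ξ) {t | t.1 < ξ})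
    {x y z : K × ℕ} (hz : z.2 ∉ N z.1) (hx : x.1 ≤ z.1) (hy : y.1 ≤ z.1)
    (hxy : colC code1 code2 h D N e0 e1 g x z = colC code1 code2 h D N e0 e1 g y z) : x = y := by
  have hb : ∀ i, blockC code2 N e1 z.1 (min i z.2) (max i z.2)
      = code2 (min i z.2) (max i z.2) := by
    intro i
    unfold blockC
    rw [if_neg]
    rintro ⟨h1, h2⟩
    rcases le_total i z.2 with h3 | h3
    · rw [max_eq_right h3] at h2; exact hz h2
    · rw [min_eq_right h3] at h1; exact hz h1
  rcases hx.lt_or_eq with hx | hx <;> rcases hy.lt_or_eq with hy | hy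
  · rw [colC_lt _ _ _ _ _ _ _ _ hx, colC_lt _ _ _ _ _ _ _ _ hy] at hxy
    simp only [crossC, hz, false_and, if_false] at hxy
    exact hh z.1 hx hy (hc.inj1 _ _ _ _ _ _ hxy).1
  · rw [colC_lt _ _ _ _ _ _ _ _ hx, colC_eq _ _ _ _ _ _ _ _ hy, hb] at hxy
    simp only [crossC, hz, false_and, if_false] at hxy
    exact absurd hxy (hc.ne12 _ _ _ _ _)
  · rw [colC_lt _ _ _ _ _ _ _ _ hy, colC_eq _ _ _ _ _ _ _ _ hx, hb] at hxy
    simp only [crossC, hz, false_and, if_false] at hxy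
    exact absurd hxy.symm (hc.ne12 _ _ _ _ _)
  · rw [colC_eq _ _ _ _ _ _ _ _ hy, colC_eq _ _ _ _ _ _ _ _ hx, hb, hb] at hxy
    have := hc.inj2 _ _ _ _ hxy
    refine Prod.ext (hx.trans hy.symm) ?_
    omega

theorem key_closure (hc : GoodCode code1 code2 third)
    (hh : ∀ ξ, Set.InjOn (h ξ) {t | t.1 < ξ})
    (he0 : ∀ ξ, ∀ i ∈ N ξ, Set.InjOn (e0 ξ i) (D ξ))
    (I : Set K) (hI : IsLowerSet I)
    (hP : ∀ η ∈ I, StageP third D N e0 η (colC code1 code2 h D N e0 e1 g) (g η))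
    (a : Set (K × ℕ)) (ha : a.Finite) (haI : ∀ x ∈ a, x.1 ∈ I) :
    ∃ B : Set (K × ℕ), B.Finite ∧ a ⊆ B ∧ (∀ x ∈ B, x.1 ∈ I) ∧
      (∀ x ∈ B, ∀ y ∈ B, x ≠ y → ∀ z, z.1 ∈ I → z ≠ x → z ≠ y →
        colC code1 code2 h D N e0 e1 g x z = colC code1 code2 h D N e0 e1 g y z → z ∈ B) := by
  rcases a.eq_empty_or_nonempty with rfl | hne
  · exact ⟨∅, Set.finite_empty, le_rfl, by simp, by simp⟩
  obtain ⟨t, hta, htmax⟩ := Set.exists_max_image a (fun x => x.1) ha hne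
  set η := t.1 with hη
  have hηI : η ∈ I := haI t hta
  obtain ⟨-, hP2⟩ := hP η hηI
  obtain ⟨B, hBf, haB, hDB, hBη, hBc, hBg⟩ := hP2 (a ∩ {x | x.1 < η})
    (ha.subset Set.inter_subset_left) (fun x hx => hx.2)
  have hcases : ∀ x ∈ B ∪ ((fun i => (η, i)) '' (N η : Set ℕ)) ∪ a, x ∈ B ∨ x.1 = η := by
    rintro x ((hx | ⟨i, _, rfl⟩) | hx)
    · exact Or.inl hx
    · exact Or.inr rfl
    · rcases (htmax x hx).lt_or_eq with h1 | h1
      · exact Or.inl (haB ⟨hx, h1⟩)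
      · exact Or.inr h1
  have hle : ∀ x ∈ B ∪ ((fun i => (η, i)) '' (N η : Set ℕ)) ∪ a, x.1 ≤ η := by
    intro x hx
    rcases hcases x hx with h1 | h1
    · exact (hBη x h1).le
    · exact h1.le
  -- mixed case
  have hmix : ∀ x ∈ B, ∀ y : K × ℕ, y.1 = η → ∀ z : K × ℕ, z.1 < η →
      colC code1 code2 h D N e0 e1 g x z = colC code1 code2 h D N e0 e1 g y z → z ∈ B := by
    intro x hx y hy z hz hxy
    rw [colC_gt _ _ _ _ _ _ _ _ (hy ▸ hz : z.1 < y.1)] at hxy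
    unfold crossC at hxy
    split_ifs at hxy with h1
    · exact hDB (hy ▸ h1.2)
    · refine hBg x hx z hz ?_
      rw [hxy, hc.third_eq, hy]
  refine ⟨B ∪ ((fun i => (η, i)) '' (N η : Set ℕ)) ∪ a,
    (hBf.union ((N η).finite_toSet.image _)).union ha, Set.subset_union_right,
    fun x hx => hI (hle x hx) hηI, ?_⟩
  intro x hx y hy hxy z hzI hzx hzy hcz
  rcases lt_trichotomy z.1 η with hz | hz | hz
  · refine Or.inl (Or.inl ?_)
    rcases hcases x hx with h1 | h1 <;> rcases hcases y hy with h2 | h2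
    · exact hBc x h1 y h2 hxy z hz hzx hzy hcz
    · exact hmix x h1 y h2 z hz hcz
    · exact hmix y h2 x h1 z hz hcz.symm
    · by_contra hzB
      have hzD : z ∉ D η := fun hD => hzB (hDB hD)
      rw [colC_gt _ _ _ _ _ _ _ _ (h1 ▸ hz : z.1 < x.1),
        colC_gt _ _ _ _ _ _ _ _ (h2 ▸ hz : z.1 < y.1)] at hcz
      simp only [crossC, h1, h2, hzD, and_false, if_false] at hcz
      exact hxy (Prod.ext (h1.trans h2.symm) (hc.inj1 _ _ _ _ _ _ hcz).2.1)
  · by_cases hzN : z.2 ∈ N η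
    · exact Or.inl (Or.inr ⟨z.2, hzN, Prod.ext hz.symm rfl⟩)
    · exact absurd (no_block hc hh (hz ▸ hzN) (hz ▸ hle x hx) (hz ▸ hle y hy) hcz) hxy
  · exact absurd (no_later hc hh he0 (hP z.1 hzI) ((hle x hx).trans_lt hz)
      ((hle y hy).trans_lt hz) hcz) hxy

end Fixed

theorem exists_stage (hdiag : PrincipleDiag) [Nonempty K] (third : Set.Iio w1 → Set.Iio w1)
    (h : K → K × ℕ → Set.Iio w1)
    (hh : ∀ ξ, Set.InjOn (h ξ) {t | t.1 < ξ})
    (D : K → Finset (K × ℕ)) (N : K → Finset ℕ) (e0 : K → ℕ → K × ℕ → Set.Iio w1)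
    (ξ : K) (hD : ∀ x ∈ D ξ, x.1 < ξ) (c : K × ℕ → K × ℕ → Set.Iio w1)
    (hcl : ∀ a : Set (K × ℕ), a.Finite → (∀ x ∈ a, x.1 < ξ) →
      ∃ B : Set (K × ℕ), B.Finite ∧ a ⊆ B ∧ (∀ x ∈ B, x.1 < ξ) ∧
      (∀ x ∈ B, ∀ y ∈ B, x ≠ y → ∀ z, z.1 < ξ → z ≠ x → z ≠ y → c x z = c y z → z ∈ B)) :
    ∃ u, StageP third D N e0 ξ c u := by
  have : ∀ a : Set (K × ℕ), ∃ B : Set (K × ℕ), a.Finite → (∀ x ∈ a, x.1 < ξ) →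
      (B.Finite ∧ a ∪ D ξ ⊆ B ∧ (∀ x ∈ B, x.1 < ξ) ∧
      (∀ x ∈ B, ∀ y ∈ B, x ≠ y → ∀ z, z.1 < ξ → z ≠ x → z ≠ y → c x z = c y z → z ∈ B)) := by
    intro a
    by_cases H : a.Finite ∧ (∀ x ∈ a, x.1 < ξ)
    · obtain ⟨B, hB⟩ := hcl (a ∪ D ξ) (H.1.union (D ξ).finite_toSet) (by
        rintro x (hx | hx)
        · exact H.2 x hx
        · exact hD x hx)
      exact ⟨B, fun _ _ => hB⟩
    · exact ⟨∅, fun h1 h2 => absurd ⟨h1, h2⟩ H⟩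
  choose m hm using this
  obtain ⟨u, hu1, hu2⟩ := diag_set hdiag {t : K × ℕ | t.1 < ξ} (h ξ) (hh ξ)
    (fun x y => third (c x y))
    (⋃ i ∈ N ξ, ⋃ y ∈ D ξ, {third (e0 ξ i y)})
    ((N ξ).finite_toSet.biUnion fun i _ => (D ξ).finite_toSet.biUnion fun y _ =>
      Set.finite_singleton _) m (by
      intro a ha haS
      have := hm a ha haS
      exact ⟨Set.subset_union_left.trans this.2.1, this.1, this.2.2.1⟩)
  refine ⟨u, ?_, ?_⟩
  · intro x _ i hi y hy hxy
    apply hu1 x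
    simp only [Set.mem_iUnion, Set.mem_singleton_iff]
    exact ⟨i, hi, y, hy, hxy⟩
  · intro a ha haS
    obtain ⟨b, hb, hab, hbS, hb'⟩ := hu2 a ha haS
    have := hm b hb hbS
    exact ⟨m b, this.1, hab.trans (Set.subset_union_left.trans this.2.1),
      Set.subset_union_right.trans this.2.1, this.2.2.1, this.2.2.2, hb'⟩

/-- Recursive choice. -/
theorem rec_choice {A : Type 1} [Nonempty A] [WellFoundedLT K] (Q : K → (K → A) → A → Prop)
    (hQ : ∀ ξ G G' u, (∀ η < ξ, G η = G' η) → Q ξ G u → Q ξ G' u) :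
    ∃ g : K → A, ∀ ξ, (∃ u, Q ξ g u) → Q ξ g (g ξ) := by
  classical
  let F : ∀ ξ : K, (∀ η, η < ξ → A) → A := fun ξ prev =>
    Classical.epsilon (fun u => Q ξ (fun η => if hη : η < ξ then prev η hη
      else Classical.arbitrary A) u)
  let g : K → A := (wellFounded_lt (α := K)).fix F
  refine ⟨g, fun ξ hu => ?_⟩
  have hg : g ξ = F ξ (fun η _ => g η) := (wellFounded_lt (α := K)).fix_eq F ξ
  obtain ⟨u, hu⟩ := hu
  have h1 : Q ξ (fun η => if hη : η < ξ then g η else Classical.arbitrary A) u :=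
    hQ ξ _ _ u (fun η hη => by simp [hη]) hu
  have h2 := Classical.epsilon_spec
    (p := fun u => Q ξ (fun η => if hη : η < ξ then g η else Classical.arbitrary A) u) ⟨u, h1⟩
  rw [hg]
  exact hQ ξ _ _ _ (fun η hη => by simp [hη]) h2

theorem exists_coloring (hdiag : PrincipleDiag) [Nonempty K] [WellFoundedLT K]
    (third : Set.Iio w1 → Set.Iio w1) (code1 : Set.Iio w1 → ℕ → Set.Iio w1 → Set.Iio w1)
    (code2 : ℕ → ℕ → Set.Iio w1) (hc : GoodCode code1 code2 third)
    (h : K → K × ℕ → Set.Iio w1)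
    (hh : ∀ ξ, Set.InjOn (h ξ) {t | t.1 < ξ})
    (D : K → Finset (K × ℕ)) (N : K → Finset ℕ) (e0 : K → ℕ → K × ℕ → Set.Iio w1)
    (e1 : K → ℕ → ℕ → Set.Iio w1)
    (hD : ∀ ξ, ∀ x ∈ D ξ, x.1 < ξ)
    (he0 : ∀ ξ, ∀ i ∈ N ξ, Set.InjOn (e0 ξ i) (D ξ)) :
    ∃ g, ∀ a : Set (K × ℕ), a.Finite → ∃ B : Set (K × ℕ), B.Finite ∧ a ⊆ B ∧
      (∀ x ∈ B, ∀ y ∈ B, x ≠ y → ∀ z, z ≠ x → z ≠ y →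
        colC code1 code2 h D N e0 e1 g x z = colC code1 code2 h D N e0 e1 g y z → z ∈ B) := by
  have : Nonempty (Set.Iio w1) := ⟨code2 0 0⟩
  obtain ⟨g, hg⟩ := rec_choice (K := K) (A := K × ℕ → Set.Iio w1)
    (fun ξ G u => StageP third D N e0 ξ (colC code1 code2 h D N e0 e1 G) u) (by
      intro ξ G G' u hGG' H
      exact H.congr (fun x y hx hy => colC_congr _ _ _ _ _ _ _ _ (hGG' _ hx) (hGG' _ hy)))
  have hP : ∀ η, StageP third D N e0 η (colC code1 code2 h D N e0 e1 g) (g η) := by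
    intro η
    induction η using (wellFounded_lt (α := K)).induction with
    | _ ξ ih =>
      apply hg
      exact exists_stage hdiag third h hh D N e0 ξ (hD ξ) _
        (key_closure hc hh he0 (Set.Iio ξ) (isLowerSet_Iio ξ) ih)
  refine ⟨g, fun a ha => ?_⟩
  obtain ⟨B, h1, h2, -, h4⟩ := key_closure hc hh he0 Set.univ isLowerSet_univ
    (fun η _ => hP η) a ha (by simp)
  exact ⟨B, h1, h2, fun x hx y hy hxy z => h4 x hx y hy hxy z trivial⟩

theorem bookkeeping {Q : Type 1} (hK : #K = aleph 2) (hini : ∀ ξ : K, #(Set.Iio ξ) ≤ aleph 1)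
    (hQ : #Q ≤ aleph 2) [Nonempty Q] :
    ∃ φ : K → Q, ∀ p β, ∃ ξ, β < ξ ∧ φ ξ = p := by
  have h0 : ℵ₀ ≤ aleph 2 := aleph0_le_aleph 2
  have : Nonempty K := by
    rw [← mk_ne_zero_iff, hK]; exact (aleph_pos 2).ne'
  have h1 : #(Q × K) ≤ #K := by
    rw [mk_prod, lift_id, lift_id, hK]
    exact (mul_le_max_of_aleph0_le_right h0).trans (max_le hQ le_rfl)
  obtain ⟨em⟩ : Nonempty ((Q × K) ↪ K) := h1
  have hψ := Function.invFun_surjective em.injective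
  set ψ := Function.invFun em
  refine ⟨fun ξ => (ψ ξ).1, fun p β => ?_⟩
  by_contra hcon
  push Not at hcon
  have h2 : ∀ k : K, em (p, k) ∈ Set.Iic β := by
    intro k
    by_contra hk
    refine hcon (em (p, k)) (not_le.1 hk) ?_
    simp [ψ, Function.leftInverse_invFun em.injective (p, k)]
  have h3 : #K ≤ #(Set.Iic β) :=
    mk_le_of_injective (f := fun k => (⟨em (p, k), h2 k⟩ : Set.Iic β)) (by
      intro k k' hkk
      have := em.injective (congrArg Subtype.val hkk)
      exact (Prod.ext_iff.1 this).2)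
  have h4 : #(Set.Iic β) ≤ aleph 1 := by
    rw [← Set.Iio_insert]
    refine (mk_insert_le).trans ?_
    refine (add_le_add (hini β) (one_le_aleph0.trans (aleph0_le_aleph 1))).trans ?_
    rw [add_eq_self (aleph0_le_aleph 1)]
  rw [hK] at h3
  exact absurd (aleph_le_aleph.1 (h3.trans h4)) (by norm_num)

abbrev KK : Type 1 := Set.Iio w2
abbrev WW : Type 1 := Set.Iio w1

theorem mk_KK : #KK = aleph 2 := by
  rw [Cardinal.mk_Iio_ordinal, w2, card_ord, lift_aleph]; simp

theorem mk_WW : #WW = aleph 1 := by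
  rw [Cardinal.mk_Iio_ordinal, w1, card_ord, lift_aleph]; simp

theorem mk_ini (ξ : KK) : #(Set.Iio ξ) ≤ aleph 1 := by
  have h1 : #(Set.Iio ξ) ≤ #(Set.Iio ξ.1) :=
    mk_le_of_injective (f := fun t => (⟨t.1.1, t.2⟩ : Set.Iio ξ.1)) (by
      intro a b hab
      have := Subtype.mk.inj hab
      exact Subtype.ext (Subtype.ext this))
  refine h1.trans ?_
  rw [Cardinal.mk_Iio_ordinal]
  have h2 : ξ.1.card < aleph 2 := lt_ord.1 ξ.2
  have h3 : (2 : Ordinal.{0}) = 1 + 1 := by norm_num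
  rw [h3, ← succ_aleph, Order.lt_succ_iff] at h2
  have := lift_le.{1}.2 h2
  rw [lift_aleph] at this
  simpa using this

instance : Zero KK := ⟨⟨0, by
  simp only [Set.mem_Iio, w2]; rw [lt_ord]; simpa using aleph_pos 2⟩⟩
instance : Zero WW := ⟨⟨0, by
  simp only [Set.mem_Iio, w1]; rw [lt_ord]; simpa using aleph_pos 1⟩⟩

abbrev Dat : Type 1 := Finset (KK × ℕ) × Finset ℕ × (ℕ × (KK × ℕ) →₀ WW) ×
  (ℕ × ℕ →₀ WW) × (ℕ →₀ (KK × ℕ))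

theorem prod_le {A : Type u} {B : Type v} {o : Ordinal.{max u v}} (hA : lift.{v} #A ≤ aleph o)
    (hB : lift.{u} #B ≤ aleph o) : #(A × B) ≤ aleph o := by
  rw [mk_prod]
  exact (mul_le_max _ _).trans (max_le (max_le hA hB) (aleph0_le_aleph o))

theorem finset_le {A : Type u} {o : Ordinal.{u}} (hA : #A ≤ aleph o) :
    #(Finset A) ≤ aleph o := by
  cases finite_or_infinite A
  · exact (lt_aleph0_of_finite _).le.trans (aleph0_le_aleph o)
  · rw [mk_finset_of_infinite]; exact hA

theorem finsupp_le {A : Type u} {B : Type v} [Zero B] {o : Ordinal.{max u v}}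
    (hA : lift.{v} #A ≤ aleph o) (hB : lift.{u} #B ≤ aleph o) : #(A →₀ B) ≤ aleph o :=
  (mk_le_of_injective (Finsupp.graph_injective A B)).trans (finset_le (prod_le hA hB))

theorem mk_Dat : #Dat ≤ aleph 2 := by
  have hT : #(KK × ℕ) ≤ aleph 2 :=
    prod_le (by rw [lift_uzero, mk_KK]) (by simp)
  have hW : #WW ≤ aleph 2 := mk_WW.le.trans (aleph_le_aleph.2 (by norm_num))
  have hNT : #(ℕ × (KK × ℕ)) ≤ aleph 2 := prod_le (by simp) (by rw [lift_uzero]; exact hT)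
  refine prod_le (by rw [lift_id]; exact finset_le hT) ?_
  rw [lift_id]
  refine prod_le (by simp) ?_
  rw [lift_uzero]
  have hf : #(ℕ × (KK × ℕ) →₀ WW) ≤ aleph 2 :=
    finsupp_le (by rw [lift_id]; exact hNT) (by rw [lift_id]; exact hW)
  refine prod_le (by rw [lift_id]; exact hf) ?_
  rw [lift_id]
  refine prod_le (by rw [lift_id]; exact finsupp_le (by simp) (by rw [lift_uzero]; exact hW)) ?_
  rw [lift_id]
  exact finsupp_le (by simp) (by rw [lift_uzero]; exact hT)

theorem exists_code : ∃ code1 code2 third, GoodCode (W := WW) code1 code2 third := by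
  have h0 : ∀ o : Ordinal.{1}, lift.{1} #ℕ ≤ aleph o := fun o => by simpa using aleph0_le_aleph o
  have hW : #WW ≤ aleph 1 := mk_WW.le
  have h1 : #((WW × ℕ × WW) ⊕ (ℕ × ℕ)) ≤ #WW := by
    rw [mk_WW, mk_sum]
    refine (add_le_max _ _).trans (max_le (max_le ?_ ?_) (aleph0_le_aleph 1))
    · rw [lift_id']
      refine prod_le (by simpa using hW) ?_
      rw [lift_id]
      exact prod_le (h0 _) (by simpa using hW)
    · simpa using aleph0_le_aleph 1
  obtain ⟨em⟩ : Nonempty (_ ↪ WW) := h1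
  refine ⟨fun a i w => em (Sum.inl (a, i, w)), fun i j => em (Sum.inr (i, j)),
    fun w => Sum.elim (fun p => p.2.2) (fun _ => 0) (Function.invFun em w), ?_, ?_, ?_, ?_⟩
  · intro a i w a' i' w' hh
    simpa using em.injective hh
  · intro i j i' j' hh
    simpa using em.injective hh
  · intro a i w j k hh
    simpa using em.injective hh
  · intro a i w
    simp [Function.leftInverse_invFun em.injective (Sum.inl (a, i, w))]

theorem exists_h : ∃ h : KK → KK × ℕ → WW, ∀ ξ, Set.InjOn (h ξ) {t | t.1 < ξ} := by
  classical
  have : ∀ ξ : KK, ∃ h : KK × ℕ → WW, Set.InjOn h {t | t.1 < ξ} := by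
    intro ξ
    have h1 : #((Set.Iio ξ) × ℕ) ≤ #WW := by
      rw [mk_WW]
      exact prod_le (by simpa using mk_ini ξ) (by simpa using aleph0_le_aleph 1)
    obtain ⟨em⟩ : Nonempty (_ ↪ WW) := h1
    refine ⟨fun t => if ht : t.1 < ξ then em (⟨t.1, ht⟩, t.2) else 0, ?_⟩
    intro x hx y hy hxy
    change x.1 < ξ at hx; change y.1 < ξ at hy
    simp only [hx, hy, dif_pos] at hxy
    have := em.injective hxy
    simp only [Prod.mk.injEq] at this
    exact Prod.ext (Subtype.mk.inj this.1) this.2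
  choose h hh using this
  exact ⟨h, hh⟩

theorem exists_equiv : Nonempty (KK ≃ KK × ℕ) := by
  refine Cardinal.eq.1 (le_antisymm ?_ ?_)
  · exact mk_le_of_injective (f := fun k => (k, 0)) (fun a b hab => (Prod.ext_iff.1 hab).1)
  · rw [mk_KK]
    exact prod_le (by rw [lift_uzero, mk_KK]) (by simpa using aleph0_le_aleph 2)

theorem exists_finsupp {A : Type u} {B : Type v} [Zero B] (s : Finset A) (f : A → B) :
    ∃ p : A →₀ B, ∀ a ∈ s, p a = f a :=
  ⟨Finsupp.indicator s (fun a _ => f a), fun a ha => by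
    classical
    rw [Finsupp.indicator_apply, dif_pos ha]⟩

/-- The theorem on the type `KK × ℕ`. -/
theorem core (hdiag : PrincipleDiag) :
    ∃ (c : KK × ℕ → KK × ℕ → WW) (r : KK × ℕ → KK × ℕ), (∀ x y, c x y = c y x) ∧
      (∀ a : Set (KK × ℕ), a.Finite → ∃ B : Set (KK × ℕ), B.Finite ∧ a ⊆ B ∧
        (∀ x ∈ B, ∀ y ∈ B, x ≠ y → ∀ z, z ≠ x → z ≠ y → c x z = c y z → z ∈ B)) ∧
      ∀ (D : Finset (KK × ℕ)) (N : Finset ℕ) (e0 : ℕ → KK × ℕ → WW) (e1 : ℕ → ℕ → WW)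
        (s : ℕ → KK × ℕ), (∀ i j, e1 i j = e1 j i) → (∀ i ∈ N, Set.InjOn (e0 i) D) →
        ∃ ξ : KK, (∀ x ∈ D, x.1 < ξ) ∧ (∀ i ∈ N, ∀ x ∈ D, c (ξ, i) x = e0 i x) ∧
          (∀ i ∈ N, ∀ j ∈ N, c (ξ, i) (ξ, j) = e1 i j) ∧ (∀ i ∈ N, r (ξ, i) = s i) := by
  classical
  obtain ⟨code1, code2, third, hc⟩ := exists_code
  obtain ⟨h, hh⟩ := exists_h
  obtain ⟨φ, hφ⟩ := bookkeeping mk_KK mk_ini mk_Dat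
  let V : KK → Prop := fun ξ => (∀ x ∈ (φ ξ).1, x.1 < ξ) ∧
    ∀ i ∈ (φ ξ).2.1, Set.InjOn (fun x => (φ ξ).2.2.1 (i, x)) (φ ξ).1
  let D : KK → Finset (KK × ℕ) := fun ξ => if V ξ then (φ ξ).1 else ∅
  let N : KK → Finset ℕ := fun ξ => if V ξ then (φ ξ).2.1 else ∅
  let e0 : KK → ℕ → KK × ℕ → WW := fun ξ i x => (φ ξ).2.2.1 (i, x)
  let e1 : KK → ℕ → ℕ → WW := fun ξ i j => (φ ξ).2.2.2.1 (i, j)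
  obtain ⟨g, hg⟩ := exists_coloring hdiag third code1 code2 hc h hh D N e0 e1 (by
      intro ξ x hx
      by_cases hV : V ξ
      · simp only [D, hV, if_true] at hx
        exact hV.1 x hx
      · simp [D, hV] at hx) (by
      intro ξ i hi
      by_cases hV : V ξ
      · simp only [D, N, hV, if_true] at hi ⊢
        exact hV.2 i hi
      · simp [N, hV] at hi)
  refine ⟨colC code1 code2 h D N e0 e1 g, fun x => (φ x.1).2.2.2.2 x.2,
    colC_symm _ _ _ _ _ _ _ _, hg, ?_⟩
  intro D' N' e0' e1' s hsymm hinj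
  obtain ⟨p0, hp0⟩ := exists_finsupp (N' ×ˢ D') (fun q => e0' q.1 q.2)
  obtain ⟨p1, hp1⟩ := exists_finsupp (N' ×ˢ N') (fun q => e1' q.1 q.2)
  obtain ⟨p2, hp2⟩ := exists_finsupp N' s
  obtain ⟨β, hβ⟩ : ∃ β : KK, ∀ x ∈ D', x.1 ≤ β := by
    obtain ⟨β, hβ⟩ := (D'.image Prod.fst).exists_le
    exact ⟨β, fun x hx => hβ _ (Finset.mem_image_of_mem _ hx)⟩
  obtain ⟨ξ, hξ, hφξ⟩ := hφ (D', N', p0, p1, p2) β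
  have hDξ : ∀ x ∈ D', x.1 < ξ := fun x hx => (hβ x hx).trans_lt hξ
  have hV : V ξ := by
    simp only [V, hφξ]
    refine ⟨hDξ, fun i hi x hx y hy hxy => hinj i hi hx hy ?_⟩
    have h1 := hp0 (i, x) (Finset.mem_product.2 ⟨hi, hx⟩)
    have h2 := hp0 (i, y) (Finset.mem_product.2 ⟨hi, hy⟩)
    simp only at hxy h1 h2
    rw [← h1, ← h2, hxy]
  have hD : D ξ = D' := by simp only [D, hV, if_true, hφξ]
  have hN : N ξ = N' := by simp only [N, hV, if_true, hφξ]
  refine ⟨ξ, hDξ, ?_, ?_, ?_⟩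
  · intro i hi x hx
    rw [colC_gt _ _ _ _ _ _ _ _ (hDξ x hx : x.1 < (ξ, i).1), crossC,
      if_pos ⟨by rw [hN]; exact hi, by rw [hD]; exact hx⟩]
    simp only [e0, hφξ]
    exact hp0 (i, x) (Finset.mem_product.2 ⟨hi, hx⟩)
  · intro i hi j hj
    have key : ∀ i ∈ N', ∀ j ∈ N', blockC code2 N e1 ξ i j = e1' i j := by
      intro i hi j hj
      rw [blockC, if_pos ⟨by rw [hN]; exact hi, by rw [hN]; exact hj⟩]
      simp only [e1, hφξ]
      exact hp1 (i, j) (Finset.mem_product.2 ⟨hi, hj⟩)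
    rw [colC_eq (x := (ξ, i)) (z := (ξ, j)) _ _ _ _ _ _ _ _ rfl]
    rcases le_total i j with hij | hij
    · simp only [hij, min_eq_left, max_eq_right]; exact key i hi j hj
    · simp only [hij, min_eq_right, max_eq_left]; rw [hsymm]; exact key j hj i hi
  · intro i hi
    simp only [hφξ]
    exact hp2 i hi

end Core

theorem stmt_1 (hdiag : PrincipleDiag) :
    ∃ (c : Ordinal.{0} → Ordinal.{0} → Ordinal.{0}) (r : Ordinal.{0} → Ordinal.{0}),
      (∀ x y, c x y = c y x) ∧
      (∀ x y, x < w2 → y < w2 → x ≠ y → c x y < w1) ∧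
      (∀ x < w2, r x < w2) ∧
      -- (a) finite agreement
      (∀ β γ, β < w2 → γ < w2 → β ≠ γ → (agreeSet c (Set.Iio w2) β γ).Finite) ∧
      -- (b) finite closure
      (∀ a : Set Ordinal.{0}, a.Finite → a ⊆ Set.Iio w2 →
        ∃ b : Set Ordinal.{0}, b.Finite ∧ a ⊆ b ∧ b ⊆ Set.Iio w2 ∧
          ∀ β ∈ b, ∀ γ ∈ b, β ≠ γ → agreeSet c (Set.Iio w2) β γ ⊆ b) ∧
      -- (c) colored finite extension with no new agreements
      (∀ d : Set Ordinal.{0}, d.Finite → d ⊆ Set.Iio (w2 + Ordinal.omega0.{0}) →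
        ∀ e : Ordinal.{0} → Ordinal.{0} → Ordinal.{0},
          (∀ x y, e x y = e y x) →
          (∀ x ∈ d, ∀ y ∈ d, x ≠ y → e x y < w1) →
          (∀ x ∈ d, ∀ y ∈ d, x < w2 → y < w2 → x ≠ y → e x y = c x y) →
          (∀ x ∈ d, ∀ y ∈ d, x < w2 → y < w2 → x ≠ y →
            agreeSet e d x y = agreeSet c (d ∩ Set.Iio w2) x y) →
          ∀ s : Ordinal.{0} → Ordinal.{0}, (∀ x ∈ d, s x < w2) →
            (∀ x ∈ d, x < w2 → s x = r x) →
            ∃ ι : Ordinal.{0} → Ordinal.{0},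
              Set.InjOn ι d ∧
              (∀ x ∈ d, ι x < w2) ∧
              (∀ x ∈ d, x < w2 → ι x = x) ∧
              (∀ x ∈ d, ∀ y ∈ d, x ≠ y → c (ι x) (ι y) = e x y) ∧
              (∀ x ∈ d, r (ι x) = s x)) := by
  
  classical
  obtain ⟨c0, r0, hsymm, hclos, hext⟩ := core hdiag
  obtain ⟨τ⟩ := exists_equiv
  let c : Ordinal.{0} → Ordinal.{0} → Ordinal.{0} := fun x y =>
    if h : x < w2 ∧ y < w2 then (c0 (τ ⟨x, h.1⟩) (τ ⟨y, h.2⟩)).1 else 0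
  let r : Ordinal.{0} → Ordinal.{0} := fun x =>
    if h : x < w2 then (τ.symm (r0 (τ ⟨x, h⟩))).1 else 0
  have hcv : ∀ x y : KK, c x.1 y.1 = (c0 (τ x) (τ y)).1 := fun x y =>
    dif_pos ⟨x.2, y.2⟩
  have hrv : ∀ x : KK, r x.1 = (τ.symm (r0 (τ x))).1 := fun x => dif_pos x.2
  have hb : ∀ a : Set Ordinal.{0}, a.Finite → a ⊆ Set.Iio w2 →
        ∃ b : Set Ordinal.{0}, b.Finite ∧ a ⊆ b ∧ b ⊆ Set.Iio w2 ∧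
          ∀ β ∈ b, ∀ γ ∈ b, β ≠ γ → agreeSet c (Set.Iio w2) β γ ⊆ b := by
    intro a ha haw
    have hfin : (τ '' (Subtype.val ⁻¹' a)).Finite :=
      (ha.preimage Subtype.val_injective.injOn).image _
    obtain ⟨B, hB, haB, hBc⟩ := hclos _ hfin
    refine ⟨(fun t => (τ.symm t).1) '' B, hB.image _, ?_, ?_, ?_⟩
    · intro x hx
      exact ⟨τ ⟨x, haw hx⟩, haB ⟨⟨x, haw hx⟩, hx, rfl⟩, by simp⟩
    · rintro _ ⟨t, _, rfl⟩
      exact (τ.symm t).2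
    · rintro _ ⟨x, hx, rfl⟩ _ ⟨y, hy, rfl⟩ hxy z ⟨hz, hzx, hzy, hcz⟩
      have hxy' : x ≠ y := by rintro rfl; exact hxy rfl
      refine ⟨τ ⟨z, hz⟩, hBc x hx y hy hxy' _ ?_ ?_ ?_, by simp⟩
      · rintro rfl; simp at hzx
      · rintro rfl; simp at hzy
      · have h1 := hcv (τ.symm x) ⟨z, hz⟩
        have h2 := hcv (τ.symm y) ⟨z, hz⟩
        rw [Equiv.apply_symm_apply] at h1 h2
        exact Subtype.ext (h1.symm.trans (hcz.trans h2))
  refine ⟨c, r, ?_, ?_, ?_, ?_, hb, ?_⟩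
  · intro x y
    by_cases h : x < w2 ∧ y < w2
    · rw [hcv ⟨x, h.1⟩ ⟨y, h.2⟩, hcv ⟨y, h.2⟩ ⟨x, h.1⟩, hsymm]
    · have h' : ¬ (y < w2 ∧ x < w2) := fun h' => h h'.symm
      simp only [c, dif_neg h, dif_neg h']
  · intro x y hx hy _
    rw [hcv ⟨x, hx⟩ ⟨y, hy⟩]
    exact (c0 _ _).2
  · intro x hx
    rw [hrv ⟨x, hx⟩]
    exact (τ.symm _).2
  · intro β γ hβ hγ hne
    obtain ⟨b, hbf, hab, -, hbc⟩ := hb {β, γ} (by simp) (by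
      rintro x (rfl | rfl)
      · exact hβ
      · exact hγ)
    exact hbf.subset (hbc β (hab (by simp)) γ (hab (by simp)) hne)
  intro d hd hdw e hes hew hec hea s hsw hsr
  let toW : Ordinal.{0} → WW := fun o => if h : o < w1 then ⟨o, h⟩ else 0
  have htoW : ∀ o, o < w1 → (toW o).1 = o := fun o ho => by simp only [toW, dif_pos ho]
  let toK : Ordinal.{0} → KK := fun o => if h : o < w2 then ⟨o, h⟩ else 0
  have htoK : ∀ o, o < w2 → (toK o).1 = o := fun o ho => by simp only [toK, dif_pos ho]
  have hDfin : (τ '' (Subtype.val ⁻¹' d)).Finite :=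
    (hd.preimage Subtype.val_injective.injOn).image _
  have haddinj : Function.Injective (fun i : ℕ => w2 + (i : Ordinal.{0})) := fun i j hij => by
    simpa using hij
  have hNfin : {i : ℕ | w2 + (i : Ordinal.{0}) ∈ d}.Finite := hd.preimage haddinj.injOn
  have hge : ∀ i : ℕ, ¬ (w2 + (i : Ordinal.{0}) < w2) := fun i => not_lt.2 le_self_add
  have hold : ∀ x : KK, x.1 ∈ d → τ x ∈ hDfin.toFinset := fun x hx => by
    simpa using hx
  have hnew : ∀ i : ℕ, w2 + (i : Ordinal.{0}) ∈ d → i ∈ hNfin.toFinset := fun i hi => by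
    simpa using hi
  have hne : ∀ (x : KK) (i : ℕ), w2 + (i : Ordinal.{0}) ≠ x.1 := fun x i h =>
    hge i (h ▸ x.2)
  obtain ⟨ξ, hξD, hξ0, hξ1, hξs⟩ := hext hDfin.toFinset hNfin.toFinset
    (fun i t => toW (e (w2 + i) (τ.symm t).1)) (fun i j => toW (e (w2 + i) (w2 + j)))
    (fun i => τ (toK (s (w2 + i)))) (fun i j => by rw [hes]) (by
      intro i hi x' hx y' hy hxy
      obtain ⟨x, rfl⟩ := τ.surjective x'
      obtain ⟨y, rfl⟩ := τ.surjective y'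
      have hi' : w2 + (i : Ordinal.{0}) ∈ d := by simpa using hi
      have hx' : x.1 ∈ d := by simpa using hx
      have hy' : y.1 ∈ d := by simpa using hy
      simp only [Equiv.symm_apply_apply] at hxy
      have hxy' := congrArg Subtype.val hxy
      rw [htoW _ (hew _ hi' _ hx' (hne x i)), htoW _ (hew _ hi' _ hy' (hne y i))] at hxy'
      by_contra hcon
      have hxyne : x.1 ≠ y.1 := fun h => hcon (congrArg τ (Subtype.ext h))
      have hmem : w2 + (i : Ordinal.{0}) ∈ agreeSet e d x.1 y.1 :=
        ⟨hi', hne x i, hne y i, by rw [hes x.1, hes y.1, hxy']⟩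
      rw [hea x.1 hx' y.1 hy' x.2 y.2 hxyne] at hmem
      exact hge i hmem.1.2)
  let ι : Ordinal.{0} → Ordinal.{0} := fun x =>
    if h : ∃ i : ℕ, x = w2 + (i : Ordinal.{0}) then (τ.symm (ξ, h.choose)).1 else x
  have hι1 : ∀ x : KK, ι x.1 = x.1 := fun x =>
    dif_neg (fun ⟨i, hi⟩ => hne x i hi.symm)
  have hι2 : ∀ i : ℕ, ι (w2 + (i : Ordinal.{0})) = (τ.symm (ξ, i)).1 := fun i => by
    have h : ∃ j : ℕ, w2 + (i : Ordinal.{0}) = w2 + (j : Ordinal.{0}) := ⟨i, rfl⟩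
    have h2 : h.choose = i := haddinj h.choose_spec.symm
    simp only [ι, dif_pos h, h2]
  have hcase : ∀ x ∈ d, (∃ x' : KK, x = x'.1) ∨ ∃ i : ℕ, x = w2 + (i : Ordinal.{0}) := by
    intro x hx
    rcases lt_or_ge x w2 with h | h
    · exact Or.inl ⟨⟨x, h⟩, rfl⟩
    · right
      have h1 : x - w2 < Ordinal.omega0 := by
        have : x < w2 + Ordinal.omega0 := hdw hx
        rwa [← Ordinal.add_sub_cancel_of_le h, add_lt_add_iff_left] at this
      obtain ⟨i, hi⟩ := Ordinal.lt_omega0.1 h1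
      exact ⟨i, by rw [← hi, Ordinal.add_sub_cancel_of_le h]⟩
  have hon : ∀ (x : KK) (i : ℕ), x.1 ∈ d → w2 + (i : Ordinal.{0}) ∈ d →
      c x.1 (τ.symm (ξ, i)).1 = e x.1 (w2 + i) := by
    intro x i hx hi
    rw [hcv, Equiv.apply_symm_apply, hsymm, hξ0 i (hnew i hi) _ (hold x hx),
      Equiv.symm_apply_apply, htoW _ (hew _ hi _ hx (hne x i)), hes]
  have hcs : ∀ x y : KK, c x.1 y.1 = c y.1 x.1 := fun x y => by rw [hcv, hcv, hsymm]
  have hone : ∀ (x : KK) (i : ℕ), x.1 ∈ d → x.1 ≠ (τ.symm (ξ, i)).1 := by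
    intro x i hx h
    have h1 : τ x = (ξ, i) := by
      rw [Subtype.ext h, Equiv.apply_symm_apply]
    have := hξD _ (hold x hx)
    rw [h1] at this
    exact lt_irrefl _ this
  refine ⟨ι, ?_, ?_, ?_, ?_, ?_⟩
  · intro x hx y hy hxy
    rcases hcase x hx with ⟨x, rfl⟩ | ⟨i, rfl⟩ <;> rcases hcase y hy with ⟨y, rfl⟩ | ⟨j, rfl⟩
    · rwa [hι1, hι1] at hxy
    · rw [hι1, hι2] at hxy
      exact absurd hxy (hone x j hx)
    · rw [hι1, hι2] at hxy
      exact absurd hxy.symm (hone y i hy)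
    · rw [hι2, hι2] at hxy
      have h1 := τ.symm.injective (Subtype.ext hxy)
      have h2 : i = j := (Prod.ext_iff.1 h1).2
      rw [h2]
  · intro x hx
    rcases hcase x hx with ⟨x, rfl⟩ | ⟨i, rfl⟩
    · rw [hι1]; exact x.2
    · rw [hι2]; exact (τ.symm _).2
  · intro x _ hxw
    exact hι1 ⟨x, hxw⟩
  · intro x hx y hy hxy
    rcases hcase x hx with ⟨x, rfl⟩ | ⟨i, rfl⟩ <;> rcases hcase y hy with ⟨y, rfl⟩ | ⟨j, rfl⟩
    · rw [hι1, hι1, hec _ hx _ hy x.2 y.2 hxy]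
    · rw [hι1, hι2, hon x j hx hy]
    · rw [hι1, hι2, hcs, hon y i hy hx, hes]
    · rw [hι2, hι2, hcv, Equiv.apply_symm_apply, Equiv.apply_symm_apply,
        hξ1 i (hnew i hx) j (hnew j hy), htoW _ (hew _ hx _ hy hxy)]
  · intro x hx
    rcases hcase x hx with ⟨x, rfl⟩ | ⟨i, rfl⟩
    · rw [hι1, hsr _ hx x.2]
    · rw [hι2, hrv, Equiv.apply_symm_apply, hξs i (hnew i hx), Equiv.symm_apply_apply,
        htoK _ (hsw _ hx)]
end

section
/- If the principle (⌐) holds, then 2^{ℵ₀} > ℵ₁, i.e., the cardinality of the continuum is strictly greater than ℵ₁. -/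
theorem stmt_2 (hdiag : PrincipleDiag) :
    Cardinal.aleph 1 < 2 ^ Cardinal.aleph0 := by
  by_contra hcon
  rw [not_lt] at hcon
  have h1 : (2 ^ Cardinal.aleph0 : Cardinal.{1}) ≤ Cardinal.aleph 1 := by
    have := Cardinal.lift_le.{1}.2 hcon
    rw [← Cardinal.lift_le]
    simpa using this
  have hI : Cardinal.mk (Set.Iio w1) = Cardinal.aleph 1 := by
    rw [Cardinal.mk_Iio_ordinal]; simp [w1]
  have hle : Cardinal.mk (ℕ → Set.Iio w1) ≤ Cardinal.mk (Set.Iio w1) := by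
    have : Cardinal.mk (ℕ → Set.Iio w1) = Cardinal.aleph 1 ^ Cardinal.aleph0 := by
      simp [hI]
    rw [this, hI]
    calc (Cardinal.aleph 1 : Cardinal.{1}) ^ Cardinal.aleph0
        ≤ (2 ^ Cardinal.aleph0) ^ Cardinal.aleph0 :=
          Cardinal.power_le_power_right (by simpa using Cardinal.aleph_one_le_continuum)
      _ = 2 ^ Cardinal.aleph0 := by rw [← Cardinal.power_mul, Cardinal.aleph0_mul_aleph0]
      _ ≤ _ := h1
  obtain ⟨e⟩ := hle
  have hnat : ∀ n : ℕ, (n : Ordinal.{0}) < w1 := fun n =>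
    (Ordinal.natCast_lt_omega0 n).trans_le (by
      rw [w1, ← Cardinal.ord_aleph0]
      exact Cardinal.ord_le_ord.2 (Cardinal.aleph0_le_aleph 1))
  haveI : Nonempty (Set.Iio w1) := ⟨⟨((0 : ℕ) : Ordinal.{0}), hnat 0⟩⟩
  let d : Ordinal.{0} → ℕ := Function.invFun (fun n : ℕ => (n : Ordinal.{0}))
  have hd : ∀ n : ℕ, d n = n := fun n => Function.leftInverse_invFun Nat.cast_injective n
  classical
  let f : Ordinal.{0} → Ordinal.{0} → Ordinal.{0} := fun α β =>
    if h : α < w1 then (Function.invFun e ⟨α, h⟩ (d β)).1 else 0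
  obtain ⟨g, hg, -, H⟩ := hdiag f
    (fun α hα β _ => by simp only [f, dif_pos hα]; exact (Function.invFun e ⟨α, hα⟩ (d β)).2)
    ∅ Set.finite_empty (Set.empty_subset _) id (fun a ha hs => ⟨subset_rfl, ha, hs⟩)
  let G : ℕ → Set.Iio w1 := fun n => ⟨g n, hg _ (hnat n)⟩
  obtain ⟨b, hb, hab, -, hB⟩ := H {(e G).1} (Set.finite_singleton _)
    (Set.singleton_subset_iff.2 (e G).2)
  have hsub : Set.range (fun n : ℕ => (n : Ordinal.{0})) ⊆ b := by
    rintro _ ⟨n, rfl⟩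
    refine hB (e G).1 (hab rfl) _ (hnat n) ?_
    have h2 : (e G).1 < w1 := (e G).2
    simp only [f, dif_pos h2, hd]
    have : Function.invFun e (e G) = G := Function.leftInverse_invFun e.injective G
    simp [this, G]
  exact Set.infinite_range_of_injective (f := fun n : ℕ => (n : Ordinal.{0}))
    Nat.cast_injective (hb.subset hsub)
end

section
/- Assume the principle (⌐) holds. Then there exists a sequence ⟨f_γ : γ < ω₂⟩ of functions from ω₁ to ω₁ with the property that for all δ < γ < ω₂, the set {α < ω₁ : f_γ(α) = f_δ(α)} is finite. -/
def W1Fun : Type 1 := {g : Ordinal.{0} → Ordinal.{0} // ∀ β < w1, g β < w1}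

theorem w1_pos : 0 < w1 := by
  unfold w1
  exact (Cardinal.isSuccLimit_ord (Cardinal.aleph0_le_aleph 1)).bot_lt

theorem exists_inj (γ : Ordinal.{0}) (hγ : γ < w2) :
    ∃ i : Ordinal.{0} → Ordinal.{0}, (∀ δ < γ, i δ < w1) ∧ Set.InjOn i (Set.Iio γ) := by
  have hc : γ.card ≤ w1.card := by
    have h1 : γ.card < Cardinal.aleph 2 := Cardinal.lt_ord.1 hγ
    have h2 : (Cardinal.aleph 2 : Cardinal.{0}) = Order.succ (Cardinal.aleph 1) := by
      rw [Cardinal.succ_aleph, one_add_one_eq_two]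
    rw [h2] at h1
    unfold w1
    rw [Cardinal.card_ord]
    exact Order.lt_succ_iff.1 h1
  have hs : Cardinal.mk (Set.Iio γ) ≤ Cardinal.mk (Set.Iio w1) := by
    rw [Cardinal.mk_Iio_ordinal, Cardinal.mk_Iio_ordinal]
    exact Cardinal.lift_le.2 hc
  obtain ⟨e⟩ := Cardinal.le_def _ _ |>.1 hs
  classical
  refine ⟨fun δ => if h : δ < γ then (e ⟨δ, h⟩).1 else 0, ?_, ?_⟩
  · intro δ h
    simp only [h, dif_pos]
    exact (e ⟨δ, h⟩).2
  · intro x hx y hy hxy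
    have hx' : x < γ := hx
    have hy' : y < γ := hy
    simp only [hx', hy', dif_pos] at hxy
    have := e.injective (Subtype.ext hxy)
    exact congrArg Subtype.val this

theorem step (hdiag : PrincipleDiag) (γ : Ordinal.{0}) (h : ∀ δ, δ < γ → W1Fun) :
    ∃ g : W1Fun, γ < w2 → ∀ δ (hδ : δ < γ), {α | α < w1 ∧ g.1 α = (h δ hδ).1 α}.Finite := by
  classical
  by_cases hγ : γ < w2
  swap
  · exact ⟨⟨fun _ => 0, fun _ _ => w1_pos⟩, fun h => absurd h hγ⟩
  obtain ⟨i, hi, hinj⟩ := exists_inj γ hγ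
  let f : Ordinal.{0} → Ordinal.{0} → Ordinal.{0} := fun α =>
    if hh : ∃ δ, δ < γ ∧ i δ = α then (h hh.choose hh.choose_spec.1).1 else fun _ => 0
  have hf : ∀ δ (hδ : δ < γ), f (i δ) = (h δ hδ).1 := by
    intro δ hδ
    have hh : ∃ δ', δ' < γ ∧ i δ' = i δ := ⟨δ, hδ, rfl⟩
    have he : hh.choose = δ := hinj hh.choose_spec.1 hδ hh.choose_spec.2
    simp only [f, dif_pos hh]
    congr 2
  have hfw : ∀ α < w1, ∀ β < w1, f α β < w1 := by
    intro α _ β hβ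
    by_cases hh : ∃ δ, δ < γ ∧ i δ = α
    · simp only [f, dif_pos hh]
      exact (h _ _).2 β hβ
    · simp only [f, dif_neg hh]
      exact w1_pos
  obtain ⟨g, hg, -, hb⟩ := hdiag f hfw ∅ Set.finite_empty (Set.empty_subset _) id
    (fun a ha haw => ⟨subset_rfl, ha, haw⟩)
  refine ⟨⟨g, hg⟩, fun _ δ hδ => ?_⟩
  obtain ⟨b, hbf, hab, -, hb⟩ := hb {i δ} (Set.finite_singleton _)
    (Set.singleton_subset_iff.2 (hi δ hδ))
  refine hbf.subset ?_
  rintro β ⟨hβ, hgβ⟩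
  refine hb (i δ) (hab rfl) β hβ ?_
  rw [hf δ hδ]
  exact hgβ.symm

theorem stmt_4 (hdiag : PrincipleDiag) :
    ∃ f : Ordinal.{0} → Ordinal.{0} → Ordinal.{0},
      (∀ γ < w2, ∀ β < w1, f γ β < w1) ∧
      ∀ δ γ, δ < γ → γ < w2 → {α | α < w1 ∧ f γ α = f δ α}.Finite := by
  choose G hG using step hdiag
  have wf : WellFounded (fun a b : Ordinal.{0} => a < b) := wellFounded_lt
  let F : Ordinal.{0} → W1Fun := wf.fix G
  have hF : ∀ γ, F γ = G γ (fun δ _ => F δ) := fun γ => wf.fix_eq G γ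
  refine ⟨fun γ => (F γ).1, fun γ _ => (F γ).2, fun δ γ hδ hγ => ?_⟩
  have := hG γ (fun δ _ => F δ) hγ δ hδ
  rw [← hF] at this
  exact this
end

section
/- Assume the principle (⌐) holds and let α be a nonzero ordinal with α < ω₂. Then for every sequence ⟨f_ξ : ξ < α⟩ of functions from α to ω₁, every finite subset F of ω₁, and every monotone map m : [α]^{<ω} → [α]^{<ω}, there exists a function g : α → ω₁ such that F ∩ ran(g) = ∅ and for every finite a ⊆ α there exists a finite b with a ⊆ b ⊆ α such that {β < α : f_ξ(β) = g(β)} ⊆ m(b) holds for all ξ ∈ m(b). -/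
theorem aux_card (α : Ordinal.{0}) (hα : α < w2) : α.card ≤ Cardinal.aleph 0 ∨ α.card = Cardinal.aleph 1 := by
  have h2 : α.card < Cardinal.aleph 2 := by
    rw [w2] at hα
    exact Cardinal.lt_ord.1 hα
  have e2 : Cardinal.aleph.{0} 2 = Order.succ (Cardinal.aleph 1) := by
    rw [← Cardinal.aleph_succ, ← Ordinal.add_one_eq_succ, one_add_one_eq_two]
  have e1 : Cardinal.aleph.{0} 1 = Order.succ (Cardinal.aleph 0) := by
    rw [← Cardinal.aleph_succ, ← Ordinal.add_one_eq_succ, zero_add]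
  rw [e2, Order.lt_succ_iff] at h2
  rcases h2.lt_or_eq with h | h
  · left
    rwa [e1, Order.lt_succ_iff] at h
  · exact Or.inr h

theorem aux_bij (α : Ordinal.{0}) (h : α.card = Cardinal.aleph 1) :
    ∃ i j : Ordinal.{0} → Ordinal.{0}, (∀ x < α, i x < w1) ∧ (∀ y < w1, j y < α) ∧
      (∀ x < α, j (i x) = x) ∧ (∀ y < w1, i (j y) = y) := by
  have hc : Cardinal.mk (Set.Iio α) = Cardinal.mk (Set.Iio w1) := by
    rw [Cardinal.mk_Iio_ordinal, Cardinal.mk_Iio_ordinal, h, w1, Cardinal.card_ord]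
  obtain ⟨e⟩ := Cardinal.eq.1 hc
  refine ⟨fun x => if hx : x < α then (e ⟨x, hx⟩ : Ordinal) else 0,
    fun y => if hy : y < w1 then (e.symm ⟨y, hy⟩ : Ordinal) else 0, ?_, ?_, ?_, ?_⟩
  · intro x hx
    simp only [hx, dif_pos]
    exact (e ⟨x, hx⟩).2
  · intro y hy
    simp only [hy, dif_pos]
    exact (e.symm ⟨y, hy⟩).2
  · intro x hx
    have h1 : (e ⟨x, hx⟩ : Ordinal) < w1 := (e ⟨x, hx⟩).2
    simp only [hx, dif_pos, h1]
    simp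
  · intro y hy
    have h1 : (e.symm ⟨y, hy⟩ : Ordinal) < α := (e.symm ⟨y, hy⟩).2
    simp only [hy, dif_pos, h1]
    simp

theorem aux_avoid (S : Set Ordinal.{0}) (hS : S.Countable) : ∃ x < w1, x ∉ S := by
  by_contra! hcon
  have hc : (Set.Iio w1).Countable := hS.mono fun x hx => hcon x hx
  have h1 := Cardinal.le_aleph0_iff_set_countable.2 hc
  rw [Cardinal.mk_Iio_ordinal, w1, Cardinal.card_ord, Cardinal.lift_aleph,
    ← Cardinal.aleph_zero, Cardinal.aleph_le_aleph] at h1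
  simp at h1

theorem stmt_7 (hdiag : PrincipleDiag) (α : Ordinal.{0}) (hα0 : α ≠ 0) (hα : α < w2) :
    ∀ f : Ordinal.{0} → Ordinal.{0} → Ordinal.{0},
      (∀ ξ < α, ∀ β < α, f ξ β < w1) →
      ∀ F : Set Ordinal.{0}, F.Finite → F ⊆ Set.Iio w1 →
        ∀ m : Set Ordinal.{0} → Set Ordinal.{0}, IsMonotoneMap α m →
          ∃ g : Ordinal.{0} → Ordinal.{0},
            (∀ β < α, g β < w1) ∧
            (∀ β < α, g β ∉ F) ∧
            ∀ a : Set Ordinal.{0}, a.Finite → a ⊆ Set.Iio α →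
              ∃ b : Set Ordinal.{0}, b.Finite ∧ a ⊆ b ∧ b ⊆ Set.Iio α ∧
                ∀ ξ ∈ m b, ∀ β < α, f ξ β = g β → β ∈ m b := by
  intro f hf F hF hFs m hm
  rcases aux_card α hα with h | h
  · have hc : (Set.Iio α).Countable := by
      rw [← Cardinal.le_aleph0_iff_set_countable, Cardinal.mk_Iio_ordinal,
        Cardinal.lift_le_aleph0, ← Cardinal.aleph_zero]
      exact h
    have hex : ∀ β, ∃ x < w1, x ∉ F ∪ (fun ξ => f ξ β) '' Set.Iio α := fun β =>
      aux_avoid _ (hF.countable.union (hc.image _))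
    choose g hg1 hg2 using hex
    refine ⟨g, fun β _ => hg1 β, fun β _ hb => hg2 β (Or.inl hb), ?_⟩
    intro a ha has
    refine ⟨a, ha, subset_rfl, has, ?_⟩
    intro ξ hξ β _ he
    exact absurd (Or.inr ⟨ξ, (hm a ha has).2.2 hξ, he⟩) (hg2 β)
  · obtain ⟨i, j, hi, hj, hji, hij⟩ := aux_bij α h
    obtain ⟨g, hg1, hg2, hg3⟩ := hdiag (fun ξ β => f (j ξ) (j β))
      (fun ξ hξ β hβ => hf _ (hj ξ hξ) _ (hj β hβ)) F hF hFs (fun a => i '' m (j '' a)) (by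
        intro a ha has
        have hjs : j '' a ⊆ Set.Iio α := by
          rintro _ ⟨y, hy, rfl⟩
          exact hj y (has hy)
        obtain ⟨h1, h2, h3⟩ := hm (j '' a) (ha.image _) hjs
        refine ⟨?_, h2.image _, ?_⟩
        · intro y hy
          exact ⟨j y, h1 ⟨y, hy, rfl⟩, hij y (has hy)⟩
        · rintro _ ⟨x, hx, rfl⟩
          exact hi x (h3 hx))
    refine ⟨fun β => g (i β), fun β hβ => hg1 _ (hi β hβ), fun β hβ => hg2 _ (hi β hβ), ?_⟩
    intro a ha has
    obtain ⟨b, hb, hab, hbs, hb3⟩ := hg3 (i '' a) (ha.image _) (by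
      rintro _ ⟨x, hx, rfl⟩
      exact hi x (has hx))
    have hjs : j '' b ⊆ Set.Iio α := by
      rintro _ ⟨y, hy, rfl⟩
      exact hj y (hbs hy)
    have h3 := (hm (j '' b) (hb.image _) hjs).2.2
    refine ⟨j '' b, hb.image _, ?_, hjs, ?_⟩
    · intro x hx
      exact ⟨i x, hab ⟨x, hx, rfl⟩, hji x (has hx)⟩
    · intro ξ hξ β hβ he
      obtain ⟨x, hx, hxe⟩ := hb3 (i ξ) ⟨ξ, hξ, rfl⟩ (i β) (hi β hβ) (by
        simp only [hji ξ (h3 hξ), hji β hβ]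
        exact he)
      have : x = β := by rw [← hji x (h3 hx), hxe, hji β hβ]
      exact this ▸ hx
end

section
/- Let α be a nonzero ordinal. Let c₀ : [α]² → ω₁ and let m₀ : [α]^{<ω} → [α]^{<ω} be a monotone map such that for every finite a ⊆ α and all distinct β, γ ∈ m₀(a), A^{c₀}_{β,γ} ⊆ m₀(a). Let s : ω₁ → α be a surjection, let ⟨·,·⟩ : ω₁ × ω₁ → ω₁ be a bijection with coordinate projections p₀, p₁ : ω₁ → ω₁ (so that ξ = ⟨p₀(ξ), p₁(ξ)⟩ for all ξ < ω₁), and let g : α → ω₁. Define c : [α+1]² → ω₁ by c ↾ [α]² = c₀ and c(α, β) = ⟨g(β), min(s⁻¹{β})⟩ for all β < α. Let m : [α+1]^{<ω} → [α+1]^{<ω} be a monotone map with m ↾ [α]^{<ω} = m₀ and the property that for every finite a ⊆ α there exists a finite b with a ⊆ b ⊆ α such that m(a ∪ {α}) = m₀(b) ∪ {α} and {γ ∈ α \ {β} : p₀(c₀(β, γ)) = g(γ)} ⊆ m₀(b) for all β ∈ m₀(b). Then for every finite a ⊆ α+1 and all distinct β, γ ∈ m(a), A^c_{β,γ} ⊆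 m(a). -/
theorem stmt_10 (α : Ordinal.{0}) (hα0 : α ≠ 0)
    (c₀ : Ordinal.{0} → Ordinal.{0} → Ordinal.{0})
    (hc₀symm : ∀ x y, c₀ x y = c₀ y x)
    (hc₀val : ∀ x y, x < α → y < α → x ≠ y → c₀ x y < w1)
    (m₀ : Set Ordinal.{0} → Set Ordinal.{0}) (hm₀ : IsMonotoneMap α m₀)
    (hm₀close : ∀ a : Set Ordinal.{0}, a.Finite → a ⊆ Set.Iio α →
      ∀ β ∈ m₀ a, ∀ γ ∈ m₀ a, β ≠ γ → agreeSet c₀ (Set.Iio α) β γ ⊆ m₀ a)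
    -- s : ω₁ → α is a surjection
    (s : Ordinal.{0} → Ordinal.{0})
    (hs : ∀ ξ < w1, s ξ < α)
    (hssurj : ∀ β < α, ∃ ξ < w1, s ξ = β)
    -- a pairing bijection ⟨·,·⟩ : ω₁ × ω₁ → ω₁ with projections p₀, p₁
    (pair : Ordinal.{0} → Ordinal.{0} → Ordinal.{0}) (p₀ p₁ : Ordinal.{0} → Ordinal.{0})
    (hpair : ∀ x < w1, ∀ y < w1, pair x y < w1)
    (hpairinj : ∀ x y x' y', x < w1 → y < w1 → x' < w1 → y' < w1 →
      pair x y = pair x' y' → x = x' ∧ y = y')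
    (hproj : ∀ ξ < w1, p₀ ξ < w1 ∧ p₁ ξ < w1 ∧ pair (p₀ ξ) (p₁ ξ) = ξ)
    -- g : α → ω₁
    (g : Ordinal.{0} → Ordinal.{0}) (hg : ∀ β < α, g β < w1)
    -- c : [α+1]² → ω₁ extends c₀ as prescribed
    (c : Ordinal.{0} → Ordinal.{0} → Ordinal.{0})
    (hcsymm : ∀ x y, c x y = c y x)
    (hcrestrict : ∀ x y, x < α → y < α → x ≠ y → c x y = c₀ x y)
    (hctop : ∀ β < α, c α β = pair (g β) (sInf {ξ | ξ < w1 ∧ s ξ = β}))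
    -- m : [α+1]^{<ω} → [α+1]^{<ω} extends m₀ as prescribed
    (m : Set Ordinal.{0} → Set Ordinal.{0}) (hm : IsMonotoneMap (α + 1) m)
    (hmrestrict : ∀ a : Set Ordinal.{0}, a.Finite → a ⊆ Set.Iio α → m a = m₀ a)
    (hmtop : ∀ a : Set Ordinal.{0}, a.Finite → a ⊆ Set.Iio α →
      ∃ b : Set Ordinal.{0}, b.Finite ∧ a ⊆ b ∧ b ⊆ Set.Iio α ∧
        m (a ∪ {α}) = m₀ b ∪ {α} ∧
        ∀ β ∈ m₀ b, ∀ γ, γ < α → γ ≠ β → p₀ (c₀ β γ) = g γ → γ ∈ m₀ b) :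
    ∀ a : Set Ordinal.{0}, a.Finite → a ⊆ Set.Iio (α + 1) →
      ∀ β ∈ m a, ∀ γ ∈ m a, β ≠ γ → agreeSet c (Set.Iio (α + 1)) β γ ⊆ m a := by
  have hmin : ∀ β < α, sInf {ξ | ξ < w1 ∧ s ξ = β} < w1 ∧ s (sInf {ξ | ξ < w1 ∧ s ξ = β}) = β := by
    intro β hβ
    obtain ⟨ξ, h1, h2⟩ := hssurj β hβ
    exact csInf_mem (s := {ξ | ξ < w1 ∧ s ξ = β}) ⟨ξ, h1, h2⟩
  have hkey : ∀ γ < α, ∀ z < α, z ≠ γ → c α z = c γ z → p₀ (c₀ γ z) = g z := by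
    intro γ hγ z hz hne h
    rw [hctop z hz, hcrestrict γ z hγ hz hne.symm] at h
    obtain ⟨h0, h1, h2⟩ := hproj _ (hc₀val γ z hγ hz hne.symm)
    exact (hpairinj _ _ _ _ h0 h1 (hg z hz) (hmin z hz).1 (h2.trans h.symm)).1
  have hlow : ∀ b : Set Ordinal.{0}, b.Finite → b ⊆ Set.Iio α → ∀ β ∈ m₀ b, ∀ γ ∈ m₀ b, β ≠ γ →
      ∀ z < α, z ≠ β → z ≠ γ → c β z = c γ z → z ∈ m₀ b := by
    intro b hb hbα β hβ γ hγ hne z hz hzβ hzγ h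
    have hβα : β < α := (hm₀ b hb hbα).2.2 hβ
    have hγα : γ < α := (hm₀ b hb hbα).2.2 hγ
    rw [hcrestrict β z hβα hz hzβ.symm, hcrestrict γ z hγα hz hzγ.symm] at h
    exact hm₀close b hb hbα β hβ γ hγ hne ⟨hz, hzβ, hzγ, h⟩
  intro a ha haα β hβ γ hγ hne z hz
  obtain ⟨hzD, hzβ, hzγ, h⟩ := hz
  have hle : ∀ x, x ∈ Set.Iio (α + 1) → x ≤ α := fun x hx => Order.lt_add_one_iff.mp hx
  by_cases hαa : α ∈ a
  · have hsub : a \ {α} ⊆ Set.Iio α := by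
      intro x hx
      exact lt_of_le_of_ne (hle x (haα hx.1)) hx.2
    obtain ⟨b, hb, -, hbα, hmb, hcl⟩ := hmtop (a \ {α}) ha.sdiff hsub
    have hEq : a \ {α} ∪ {α} = a := by
      rw [Set.diff_union_self, Set.union_eq_left]
      simpa using hαa
    rw [hEq] at hmb
    rw [hmb] at hβ hγ ⊢
    rcases eq_or_lt_of_le (hle z hzD) with hzα | hzα
    · exact Or.inr hzα
    left
    have hlt : ∀ x ∈ m₀ b, x < α := fun x hx => (hm₀ b hb hbα).2.2 hx
    rcases hβ with hβ | hβ
    · rcases hγ with hγ | hγ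
      · exact hlow b hb hbα β hβ γ hγ hne z hzα hzβ hzγ h
      · obtain rfl : γ = α := hγ
        exact hcl β hβ z hzα hzβ (hkey β (hlt β hβ) z hzα hzβ h.symm)
    · obtain rfl : β = α := hβ
      rcases hγ with hγ | hγ
      · exact hcl γ hγ z hzα hzγ (hkey γ (hlt γ hγ) z hzα hzγ h)
      · exact absurd hγ.symm hne
  · have hsub : a ⊆ Set.Iio α := by
      intro x hx
      exact lt_of_le_of_ne (hle x (haα hx)) (fun e => hαa (e ▸ hx))
    rw [hmrestrict a ha hsub] at hβ hγ ⊢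
    rcases eq_or_lt_of_le (hle z hzD) with hzα | hzα
    · exfalso
      subst hzα
      have hβα : β < z := (hm₀ a ha hsub).2.2 hβ
      have hγα : γ < z := (hm₀ a ha hsub).2.2 hγ
      rw [hcsymm β z, hcsymm γ z, hctop β hβα, hctop γ hγα] at h
      have h2 := (hpairinj _ _ _ _ (hg β hβα) (hmin β hβα).1 (hg γ hγα) (hmin γ hγα).1 h).2
      apply hne
      rw [← (hmin β hβα).2, h2, (hmin γ hγα).2]
    · exact hlow a ha hsub β hβ γ hγ hne z hzα hzβ hzγ h
end

section
/- Assume the principle (⌐) holds. Let α be a nonzero ordinal with α < ω₂, let s : ω₁ → α be a surjection, let ⟨·,·⟩ : ω₁ × ω₁ → ω₁ be a bijection with coordinate projections p₀, p₁ : ω₁ → ω₁ (so that ξ = ⟨p₀(ξ), p₁(ξ)⟩ for all ξ < ω₁), let F be a finite subset of ω₁, let c₀ : [α]² → ω₁, and let m₀ : [α]^{<ω} → [α]^{<ω} be a monotone map. Then there exist a function g : α → ω₁ with F ∩ ran(g) = ∅ and a monotone map m : [α+1]^{<ω} → [α+1]^{<ω} with m ↾ [α]^{<ω} = m₀ such that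 for every finite a ⊆ α there exists a finite b with a ⊆ b ⊆ α satisfying m(a ∪ {α}) = m₀(b) ∪ {α} and {γ ∈ α \ {β} : p₀(c₀(β, γ)) = g(γ)} ⊆ m₀(b) for all β ∈ m₀(b). (In other words, the pair consisting of the extension c of c₀ to [α+1]² defined by c(α, β) = ⟨g(β), min(s⁻¹{β})⟩ together with m is an F-good extension of (c₀, m₀).) -/
theorem stmt_12 (hdiag : PrincipleDiag) (α : Ordinal.{0}) (hα0 : α ≠ 0) (hα : α < w2)
    -- s : ω₁ → α is a surjection
    (s : Ordinal.{0} → Ordinal.{0})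
    (hs : ∀ ξ < w1, s ξ < α)
    (hssurj : ∀ β < α, ∃ ξ < w1, s ξ = β)
    -- a pairing bijection ⟨·,·⟩ : ω₁ × ω₁ → ω₁ with projections p₀, p₁
    (pair : Ordinal.{0} → Ordinal.{0} → Ordinal.{0}) (p₀ p₁ : Ordinal.{0} → Ordinal.{0})
    (hpair : ∀ x < w1, ∀ y < w1, pair x y < w1)
    (hpairinj : ∀ x y x' y', x < w1 → y < w1 → x' < w1 → y' < w1 →
      pair x y = pair x' y' → x = x' ∧ y = y')
    (hproj : ∀ ξ < w1, p₀ ξ < w1 ∧ p₁ ξ < w1 ∧ pair (p₀ ξ) (p₁ ξ) = ξ)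
    (F : Set Ordinal.{0}) (hF : F.Finite) (hFsub : F ⊆ Set.Iio w1)
    (c₀ : Ordinal.{0} → Ordinal.{0} → Ordinal.{0})
    (hc₀symm : ∀ x y, c₀ x y = c₀ y x)
    (hc₀val : ∀ x y, x < α → y < α → x ≠ y → c₀ x y < w1)
    (m₀ : Set Ordinal.{0} → Set Ordinal.{0}) (hm₀ : IsMonotoneMap α m₀) :
    ∃ (g : Ordinal.{0} → Ordinal.{0}) (m : Set Ordinal.{0} → Set Ordinal.{0}),
      (∀ β < α, g β < w1) ∧
      (∀ β < α, g β ∉ F) ∧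
      IsMonotoneMap (α + 1) m ∧
      (∀ a : Set Ordinal.{0}, a.Finite → a ⊆ Set.Iio α → m a = m₀ a) ∧
      (∀ a : Set Ordinal.{0}, a.Finite → a ⊆ Set.Iio α →
        ∃ b : Set Ordinal.{0}, b.Finite ∧ a ⊆ b ∧ b ⊆ Set.Iio α ∧
          m (a ∪ {α}) = m₀ b ∪ {α} ∧
          ∀ β ∈ m₀ b, ∀ γ, γ < α → γ ≠ β → p₀ (c₀ β γ) = g γ → γ ∈ m₀ b) := by
  classical
  have hw : (0 : Ordinal.{0}) < w1 := by
    obtain ⟨ξ, hξ, -⟩ := hssurj 0 (pos_iff_ne_zero.2 hα0)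
    exact lt_of_le_of_lt zero_le hξ
  choose! t ht hst using hssurj
  obtain ⟨g, hg, hgF, hgb⟩ := hdiag
    (fun ξ η => if s ξ = s η then 0 else p₀ (c₀ (s ξ) (s η)))
    (by
      intro ξ hξ η hη
      split_ifs with h
      · exact hw
      · exact (hproj _ (hc₀val _ _ (hs ξ hξ) (hs η hη) h)).1)
    F hF hFsub (fun b => b ∪ t '' m₀ (s '' b))
    (by
      intro a ha haw
      have hsa : s '' a ⊆ Set.Iio α := by
        rintro _ ⟨x, hx, rfl⟩
        exact hs x (haw hx)
      obtain ⟨h1, h2, h3⟩ := hm₀ (s '' a) (ha.image s) hsa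
      refine ⟨Set.subset_union_left, ha.union (h2.image t), Set.union_subset haw ?_⟩
      rintro _ ⟨x, hx, rfl⟩
      exact ht x (h3 hx))
  have key : ∀ a : Set Ordinal.{0}, a.Finite → a ⊆ Set.Iio α →
        ∃ b : Set Ordinal.{0}, b.Finite ∧ a ⊆ b ∧ b ⊆ Set.Iio α ∧
          ∀ β ∈ m₀ b, ∀ γ, γ < α → γ ≠ β → p₀ (c₀ β γ) = g (t γ) → γ ∈ m₀ b := by
    intro a ha haα
    obtain ⟨b, hb, hab, hbw, hfb⟩ := hgb (t '' a) (ha.image t) (by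
      rintro _ ⟨x, hx, rfl⟩
      exact ht x (haα hx))
    have hsb : s '' b ⊆ Set.Iio α := by
      rintro _ ⟨x, hx, rfl⟩
      exact hs x (hbw hx)
    obtain ⟨h1, h2, h3⟩ := hm₀ (s '' b) (hb.image s) hsb
    refine ⟨s '' b, hb.image s, ?_, hsb, ?_⟩
    · intro x hx
      exact ⟨t x, hab ⟨x, hx, rfl⟩, hst x (haα hx)⟩
    · intro β hβ γ hγ hne hc
      have hβα : β < α := h3 hβ
      have := hfb (t β) (Or.inr ⟨β, hβ, rfl⟩) (t γ) (ht γ hγ) (by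
        simp only [hst β hβα, hst γ hγ]
        rw [if_neg (Ne.symm hne), hc])
      rcases this with h | ⟨x, hx, hxe⟩
      · exact h1 ⟨t γ, h, hst γ hγ⟩
      · have : x = γ := by rw [← hst x (h3 hx), hxe, hst γ hγ]
        exact this ▸ hx
  choose! B hBfin haB hBα hB using key
  refine ⟨fun γ => g (t γ), fun a => if α ∈ a then m₀ (B (a \ {α})) ∪ {α} else m₀ a,
    fun β hβ => hg _ (ht β hβ), fun β hβ => hgF _ (ht β hβ), ?_, ?_, ?_⟩
  · intro a ha haα
    have hle : ∀ x ∈ a, x ≤ α := fun x hx => Order.lt_add_one_iff.1 (haα hx)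
    dsimp only
    split_ifs with h
    · have hf : (a \ {α}).Finite := ha.subset Set.sdiff_subset
      have hsub : a \ {α} ⊆ Set.Iio α := fun x hx => lt_of_le_of_ne (hle x hx.1) hx.2
      obtain ⟨h1, h2, h3⟩ := hm₀ _ (hBfin _ hf hsub) (hBα _ hf hsub)
      refine ⟨?_, h2.union (Set.finite_singleton α), ?_⟩
      · intro x hx
        by_cases hxα : x = α
        · exact Or.inr hxα
        · exact Or.inl (h1 (haB _ hf hsub ⟨hx, hxα⟩))
      · rintro x (hx | hx)
        · exact lt_trans (Set.mem_Iio.1 (h3 hx)) (lt_add_one α)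
        · exact Order.lt_add_one_iff.2 (le_of_eq hx)
    · obtain ⟨h1, h2, h3⟩ := hm₀ a ha
        (fun x hx => lt_of_le_of_ne (hle x hx) (fun e => h (e ▸ hx)))
      exact ⟨h1, h2, fun x hx => lt_trans (Set.mem_Iio.1 (h3 hx)) (lt_add_one α)⟩
  · intro a ha haα
    exact if_neg (fun h => lt_irrefl α (haα h))
  · intro a ha haα
    refine ⟨B a, hBfin a ha haα, haB a ha haα, hBα a ha haα, ?_, hB a ha haα⟩
    have hd : (a ∪ {α}) \ {α} = a := by
      ext x
      constructor
      · rintro ⟨hx | hx, hn⟩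
        · exact hx
        · exact absurd hx hn
      · intro hx
        exact ⟨Or.inl hx, fun e => lt_irrefl α (haα ((show x = α from e) ▸ hx))⟩
    dsimp only
    rw [if_pos (show α ∈ a ∪ {α} from Or.inr rfl), hd]
end
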